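/- Let A ∈ ℝ^{n×n} be symmetric positive semidefinite with eigenvalues λ₁ ≥ … ≥ λ_n ≥ 0, let λ > 0, let δ ∈ (0,1), and let n_Ω = q + p with integers q, p ≥ 2 and λ_q > 0. Let Ω ∈ ℝ^{n×n_Ω} have independent standard Gaussian entries, let W_k have orthonormal columns spanning the block Krylov subspace K_k(A, Ω) with k ≥ 2, and set T_k = W_kᵀ A W_k. Then with probability at least 1 − δ over the draw of Ω: 0 ≤ Trace(log(λ I + A)) − Trace(log(λ I + W_k T_k W_kᵀ)) ≤ Trace(log(I + C · (λ_{q+1}/λ_q) · T_{k−2}(（2λ_q − λ_{q+1})/λ_{q+1})^{−2} · λ^{−1} Λ₂)) + Trace(log(I + λ^{−1} Λ₂)), where C = (√(n−q) + √(n_Ω) + √(2 log(2/δ)))² · (2/δ)^{2/(p+1)} · (e√(n_Ω)/(p+1))², T_{k−2} is the Chebyshev polynomial of the first kind of degree k−2, and Λ₂ = diag(λ_{q+1}, …, λ_n). -/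

import Mathlib

open Matrix

/-- Euclidean norm of a vector in `ℝ^m`. -/
noncomputable def euclNorm {m : ℕ} (y : Fin m → ℝ) : ℝ :=
  Real.sqrt (y ⬝ᵥ y)

/-- The `A`-norm `‖v‖_A = √(vᵀ A v)`. -/
noncomputable def anorm {m : ℕ} (A : Matrix (Fin m) (Fin m) ℝ) (v : Fin m → ℝ) : ℝ :=
  Real.sqrt (v ⬝ᵥ A *ᵥ v)

/-- The range (column span) of a matrix `W ∈ ℝ^{m×r}`. -/
def colSpan {m r : ℕ} (W : Matrix (Fin m) (Fin r) ℝ) : Submodule ℝ (Fin m → ℝ) :=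
  Submodule.span ℝ (Set.range Wᵀ)

/-- The block Krylov subspace `K_k(A, Z)`, the span of the columns of
`Z, AZ, …, A^{k-1} Z`. -/
def krylov {m b : ℕ} (k : ℕ) (A : Matrix (Fin m) (Fin m) ℝ)
    (Z : Matrix (Fin m) (Fin b) ℝ) : Submodule ℝ (Fin m → ℝ) :=
  Submodule.span ℝ (⋃ j ∈ Finset.range k, Set.range (A ^ j * Z)ᵀ)

/-- The Krylov subspace `K_k(A, y)` for a vector `y`, the span of
`y, Ay, …, A^{k-1} y`. -/
def krylovVec {m : ℕ} (k : ℕ) (A : Matrix (Fin m) (Fin m) ℝ)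
    (y : Fin m → ℝ) : Submodule ℝ (Fin m → ℝ) :=
  Submodule.span ℝ {v | ∃ j < k, v = (A ^ j) *ᵥ y}

/-- Condition number: ratio of the largest to the smallest eigenvalue
(for a symmetric positive definite matrix, the spectrum is the set of its eigenvalues). -/
noncomputable def condNum {m : ℕ} (A : Matrix (Fin m) (Fin m) ℝ) : ℝ :=
  sSup (spectrum ℝ A) / sInf (spectrum ℝ A)

/-- `Trace(log M) = log (det M)` for a symmetric positive definite matrix `M`. -/
noncomputable def traceLog {n : ℕ} (M : Matrix (Fin n) (Fin n) ℝ) : ℝ :=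
  Real.log M.det

/-- The eigenvalues of a symmetric matrix, sorted in decreasing order:
`eigDesc M i` is the `i`-th largest eigenvalue of `M` (`i` is 0-based). -/
noncomputable def eigDesc {m : ℕ} (M : Matrix (Fin m) (Fin m) ℝ) : Fin m → ℝ :=
  open scoped Classical in
  if h : M.IsHermitian then fun i => (h.eigenvalues ∘ Tuple.sort h.eigenvalues) i.rev
  else 0



section LinAlg
set_option linter.unusedSectionVars false
variable {ι : Type*} [Fintype ι] [DecidableEq ι]

lemma kb_psd_of_form {M : Matrix ι ι ℝ} (hM : Mᵀ = M) (h : ∀ v, 0 ≤ v ⬝ᵥ M *ᵥ v) :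
    M.PosSemidef := by
  refine PosSemidef.of_dotProduct_mulVec_nonneg ?_ ?_
  · rw [IsHermitian, conjTranspose_eq_transpose_of_trivial, hM]
  · intro v; simpa using h v

lemma kb_one_le_det {M : Matrix ι ι ℝ} (hM : M.PosSemidef) : 1 ≤ (1 + M).det := by
  have h1 : (1 + M).PosDef := PosDef.one.add_posSemidef hM
  have h2 := h1.isHermitian
  rw [h2.det_eq_prod_eigenvalues]
  have : ∀ i, 1 ≤ h2.eigenvalues i := by
    intro i
    rw [h2.eigenvalues_eq i]
    set v := (h2.eigenvectorBasis i) with hv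
    have h3 : v.ofLp ⬝ᵥ v.ofLp = 1 := by
      have := h2.eigenvectorBasis.orthonormal.1 i
      have h4 : inner ℝ v v = (1:ℝ) := by
        rw [real_inner_self_eq_norm_sq, hv, this]; norm_num
      rw [PiLp.inner_apply] at h4
      simpa [dotProduct, -inner_self_eq_norm_sq_to_K, ← pow_two] using h4
    have h5 := hM.re_dotProduct_nonneg v.ofLp
    simp [add_mulVec, dotProduct_add] at h5 ⊢
    rw [h3]; linarith
  have := Finset.prod_le_prod (s := Finset.univ) (f := fun _ : ι => (1:ℝ)) (g := h2.eigenvalues)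
    (fun _ _ => zero_le_one) (fun i _ => this i)
  simpa using this

lemma kb_gram {κ : Type*} [Fintype κ] (B : Matrix κ ι ℝ) : (Bᵀ * B).PosSemidef := by
  have := posSemidef_conjTranspose_mul_self B
  rwa [conjTranspose_eq_transpose_of_trivial] at this

lemma kb_conj {κ : Type*} [Fintype κ] {M : Matrix ι ι ℝ} (hM : M.PosSemidef) (B : Matrix κ ι ℝ) :
    (B * M * Bᵀ).PosSemidef := by
  have := hM.mul_mul_conjTranspose_same B
  rwa [conjTranspose_eq_transpose_of_trivial] at this

lemma kb_det_add_gram {κ : Type*} [Fintype κ] [DecidableEq κ] {N : Matrix ι ι ℝ} (hN : N.PosDef)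
    (B : Matrix κ ι ℝ) :
    (N + Bᵀ * B).det = N.det * (1 + B * N⁻¹ * Bᵀ).det := by
  have hu : IsUnit N.det := isUnit_iff_ne_zero.2 hN.det_pos.ne'
  have : N + Bᵀ * B = N * (1 + (N⁻¹ * Bᵀ) * B) := by
    rw [mul_add, mul_one, Matrix.mul_assoc N⁻¹, Matrix.mul_nonsing_inv_cancel_left _ _ hu]
  rw [this, det_mul, det_one_add_mul_comm, Matrix.mul_assoc]

open scoped MatrixOrder in
lemma kb_det_mono {M E : Matrix ι ι ℝ} (hM : M.PosDef) (hE : E.PosSemidef) :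
    M.det ≤ (M + E).det := by
  obtain ⟨B, rfl⟩ := CStarAlgebra.nonneg_iff_eq_star_mul_self.mp hE.nonneg
  rw [star_eq_conjTranspose, conjTranspose_eq_transpose_of_trivial, kb_det_add_gram hM]
  have h1 : (B * M⁻¹ * Bᵀ).PosSemidef := by
    exact kb_conj hM.inv.posSemidef B
  have := kb_one_le_det h1
  nlinarith [hM.det_pos]

lemma kb_det_mono' {M N : Matrix ι ι ℝ} (hM : M.PosSemidef) (hE : (N - M).PosSemidef) :
    (1 + M).det ≤ (1 + N).det := by
  have := kb_det_mono (M := 1 + M) (PosDef.one.add_posSemidef hM) hE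
  simpa [add_assoc] using this

lemma kb_det_sub {Y : Matrix ι ι ℝ} (hY : Y.PosSemidef) {κ : Type*} [Fintype κ] [DecidableEq κ]
    (B : Matrix κ ι ℝ) :
    (1 + Y + Bᵀ * B).det ≤ (1 + Y).det * (1 + B * Bᵀ).det := by
  have hN : (1 + Y).PosDef := PosDef.one.add_posSemidef hY
  rw [kb_det_add_gram hN]
  have hu : IsUnit (1 + Y).det := isUnit_iff_ne_zero.2 hN.det_pos.ne'
  have h1 : (1 - (1 + Y)⁻¹).PosSemidef := by
    have h2 : (Y + Yᴴ * Y).PosSemidef := hY.add (posSemidef_conjTranspose_mul_self Y)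
    have h3 := h2.mul_mul_conjTranspose_same ((1 + Y)⁻¹)
    have h4 : (1 - (1 + Y)⁻¹) = (1 + Y)⁻¹ * (Y + Yᴴ * Y) * ((1 + Y)⁻¹)ᴴ := by
      rw [hY.isHermitian.eq, hN.inv.isHermitian.eq]
      have : Y + Y * Y = Y * (1 + Y) := by rw [mul_add, mul_one]
      rw [this, Matrix.mul_assoc, Matrix.mul_nonsing_inv_cancel_right _ _ hu]
      have h5 := Matrix.nonsing_inv_mul (1 + Y) hu
      rw [mul_add, mul_one] at h5
      exact (sub_eq_of_eq_add' h5.symm)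
    rw [h4]; exact h3
  refine mul_le_mul_of_nonneg_left ?_ hN.det_pos.le
  apply kb_det_mono'
  · exact kb_conj hN.inv.posSemidef B
  · have := kb_conj h1 B
    rwa [Matrix.mul_sub, Matrix.sub_mul, Matrix.mul_one] at this

lemma kb_det_proj {A S P S2 : Matrix ι ι ℝ} (hS : Sᵀ = S) (hSA : S * S = A) (hP : Pᵀ = P)
    (hPP : P * P = P) (hS2 : S2ᵀ = S2) (c : ℝ) (hc : 0 ≤ c)
    (h : ∀ v, P *ᵥ v = 0 → v ⬝ᵥ A *ᵥ v ≤ c * ((S2 *ᵥ v) ⬝ᵥ (S2 *ᵥ v))) :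
    0 < (1 + P * A * P).det ∧ (1 + P * A * P).det ≤ (1 + A).det ∧
    (1 + A).det ≤ (1 + P * A * P).det * (1 + c • (S2 * S2)).det := by
  have e1 : (1 + P * A * P).det = (1 + S * P * S).det := by
    have : P * A * P = (P * S) * (S * P) := by rw [← hSA]; simp [Matrix.mul_assoc]
    rw [this, det_one_add_mul_comm]
    congr 2
    calc S * P * (P * S) = S * (P * P) * S := by simp [Matrix.mul_assoc]
      _ = _ := by rw [hPP]
  have hQt : (1 - P)ᵀ = 1 - P := by rw [transpose_sub, transpose_one, hP]
  have hQQ : (1 - P) * (1 - P) = 1 - P := by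
    rw [sub_mul, one_mul, mul_sub, mul_one, hPP]; simp
  have hY : (S * P * S).PosSemidef := by
    have := kb_gram (P * S)
    rw [transpose_mul, hP, hS] at this
    have e : S * P * (P * S) = S * P * S := by
      rw [← Matrix.mul_assoc, Matrix.mul_assoc S P P, hPP]
    rwa [e] at this
  have eB : ((1 - P) * S)ᵀ * ((1 - P) * S) = A - S * P * S := by
    rw [transpose_mul, hS, hQt, ← Matrix.mul_assoc, Matrix.mul_assoc S, hQQ, ← hSA]
    simp [mul_sub, sub_mul]
  have hE : (A - S * P * S).PosSemidef := by
    rw [← eB]; exact kb_gram _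
  refine ⟨?_, ?_, ?_⟩
  · rw [e1]; linarith [kb_one_le_det hY]
  · rw [e1]; exact kb_det_mono' hY hE
  · have h1 := kb_det_sub hY ((1 - P) * S)
    have : 1 + S * P * S + ((1 - P) * S)ᵀ * ((1 - P) * S) = 1 + A := by rw [eB]; abel
    rw [this] at h1
    rw [e1]
    refine h1.trans (mul_le_mul_of_nonneg_left ?_ (by linarith [kb_one_le_det hY]))
    have e3 : ((1 - P) * S) * ((1 - P) * S)ᵀ = (1 - P) * A * (1 - P) := by
      rw [transpose_mul, hS, hQt, ← hSA]; simp only [Matrix.mul_assoc]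
    rw [e3]
    have step1 : (1 + (1 - P) * A * (1 - P)).det ≤ 
        (1 + c • ((1 - P) * (S2 * S2) * (1 - P))).det := by
      apply kb_det_mono'
      · rw [← e3]; simpa only [transpose_transpose] using kb_gram ((1 - P) * S)ᵀ
      · apply kb_psd_of_form
        · have hAt : Aᵀ = A := by rw [← hSA, transpose_mul, hS]
          simp only [transpose_sub, transpose_smul, transpose_mul, hP, hS2, transpose_one, hAt,
            Matrix.mul_assoc]
        · intro v
          have h0 : P *ᵥ ((1 - P) *ᵥ v) = 0 := by
            rw [mulVec_mulVec, mul_sub, mul_one, hPP, sub_self, zero_mulVec]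
          have := h _ h0
          have gen : ∀ M : Matrix ι ι ℝ, v ⬝ᵥ ((1 - P) * M * (1 - P)) *ᵥ v =
              ((1 - P) *ᵥ v) ⬝ᵥ M *ᵥ ((1 - P) *ᵥ v) := by
            intro M
            rw [← mulVec_mulVec, ← mulVec_mulVec, dotProduct_mulVec v (1 - P), ← mulVec_transpose,
              hQt]
          rw [sub_mulVec, dotProduct_sub, smul_mulVec, dotProduct_smul, gen, gen, smul_eq_mul]
          rw [← mulVec_mulVec, dotProduct_mulVec _ S2 (S2 *ᵥ _), ← mulVec_transpose, hS2]
          linarith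
    refine step1.trans ?_
    have e4 : (1 + c • ((1 - P) * (S2 * S2) * (1 - P))).det
        = (1 + c • (S2 * (1 - P) * S2)).det := by
      have : c • ((1 - P) * (S2 * S2) * (1 - P)) = (c • ((1 - P) * S2)) * (S2 * (1 - P)) := by
        simp [Matrix.mul_assoc]
      rw [this, det_one_add_mul_comm]
      congr 2
      rw [Matrix.mul_smul]
      congr 1
      calc S2 * (1 - P) * ((1 - P) * S2) = S2 * ((1 - P) * (1 - P)) * S2 := by
            simp only [Matrix.mul_assoc]
        _ = _ := by rw [hQQ]
    rw [e4]
    apply kb_det_mono'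
    · apply PosSemidef.smul _ hc
      have := kb_gram ((1 - P) * S2)
      rw [transpose_mul, hQt, hS2] at this
      have e : S2 * (1 - P) * ((1 - P) * S2) = S2 * (1 - P) * S2 := by
        rw [← Matrix.mul_assoc, Matrix.mul_assoc S2 (1 - P) (1 - P), hQQ]
      rwa [e] at this
    · rw [← smul_sub]
      apply PosSemidef.smul _ hc
      have := kb_gram (P * S2)
      rw [transpose_mul, hP, hS2] at this
      have e : S2 * P * (P * S2) = S2 * S2 - S2 * (1 - P) * S2 := by
        rw [← Matrix.mul_assoc, Matrix.mul_assoc S2 P P, hPP]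
        simp [mul_sub, sub_mul]
      rwa [e] at this
end LinAlg

section Determ

lemma kb_eig {n : ℕ} {A : Matrix (Fin n) (Fin n) ℝ} (hA : A.PosSemidef) :
    ∃ U : Matrix (Fin n) (Fin n) ℝ, Uᵀ * U = 1 ∧ U * Uᵀ = 1 ∧
      A = U * diagonal (eigDesc A) * Uᵀ ∧ Antitone (eigDesc A) ∧ ∀ i, 0 ≤ eigDesc A i := by
  have h := hA.isHermitian
  have hd : eigDesc A = fun i => (h.eigenvalues ∘ Tuple.sort h.eigenvalues) i.rev := by
    unfold eigDesc; rw [dif_pos h]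
  set e : Fin n ≃ Fin n := Fin.revPerm.trans (Tuple.sort h.eigenvalues) with he
  have hd' : eigDesc A = h.eigenvalues ∘ e := by rw [hd]; rfl
  set V : Matrix (Fin n) (Fin n) ℝ := (h.eigenvectorUnitary : Matrix (Fin n) (Fin n) ℝ) with hV
  have hV1 : Vᵀ * V = 1 := by
    have := Unitary.coe_star_mul_self h.eigenvectorUnitary
    rwa [star_eq_conjTranspose, conjTranspose_eq_transpose_of_trivial] at this
  have hV2 : V * Vᵀ = 1 := mul_eq_one_comm.1 hV1
  have hVA : A = V * diagonal h.eigenvalues * Vᵀ := by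
    have := h.spectral_theorem
    rw [Unitary.conjStarAlgAut_apply, star_eq_conjTranspose,
      conjTranspose_eq_transpose_of_trivial] at this
    simpa using this
  refine ⟨V.submatrix id e, ?_, ?_, ?_, ?_, ?_⟩
  · apply mul_eq_one_comm.1
    rw [transpose_submatrix, submatrix_mul_equiv V Vᵀ id e id, hV2]
    simp
  · rw [transpose_submatrix, submatrix_mul_equiv V Vᵀ id e id, hV2]
    simp
  · rw [hd', ← submatrix_diagonal_equiv, transpose_submatrix,
      submatrix_mul_equiv V _ id e e, submatrix_mul_equiv _ Vᵀ id e id, ← hVA]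
    simp
  · rw [hd]
    intro i j hij
    exact Tuple.monotone_sort h.eigenvalues (Fin.rev_le_rev.2 hij)
  · intro i; rw [hd']; exact hA.eigenvalues_nonneg _

variable {n N q k : ℕ}

lemma kb_orth {A : Matrix (Fin n) (Fin n) ℝ} {Om : Matrix (Fin n) (Fin N) ℝ} {r : ℕ}
    {W : Matrix (Fin n) (Fin r) ℝ} (hW : Wᵀ * W = 1) (hK : colSpan W = krylov k A Om)
    (v : Fin n → ℝ) (hv : (W * Wᵀ) *ᵥ v = 0) (j : ℕ) (hj : j < k) :
    (A ^ j * Om)ᵀ *ᵥ v = 0 := by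
  have h1 : Wᵀ *ᵥ v = 0 := by
    have : Wᵀ *ᵥ ((W * Wᵀ) *ᵥ v) = Wᵀ *ᵥ v := by
      rw [mulVec_mulVec, ← Matrix.mul_assoc, hW, Matrix.one_mul]
    rw [← this, hv, mulVec_zero]
  have h2 : ∀ x ∈ colSpan W, x ⬝ᵥ v = 0 := by
    intro x hx
    unfold colSpan at hx
    induction hx using Submodule.span_induction with
    | mem x hx => 
      obtain ⟨i, rfl⟩ := hx
      exact congrFun h1 i
    | zero => simp
    | add x y _ _ hx hy => rw [add_dotProduct, hx, hy, add_zero]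
    | smul a x _ hx => rw [smul_dotProduct, hx, smul_zero]
  ext i
  apply h2
  rw [hK]
  apply Submodule.subset_span
  simp only [Set.mem_iUnion]
  exact ⟨j, Finset.mem_range.2 hj, i, rfl⟩

lemma kb_pow {U A : Matrix (Fin n) (Fin n) ℝ} {d : Fin n → ℝ} (hU : Uᵀ * U = 1) (hU' : U * Uᵀ = 1)
    (hA : A = U * diagonal d * Uᵀ) (j : ℕ) : A ^ j = U * diagonal (fun i => d i ^ j) * Uᵀ := by
  induction j with
  | zero => simp [hU']
  | succ j ih =>
    rw [pow_succ, ih, hA]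
    calc _ = U * diagonal (fun i => d i ^ j) * (Uᵀ * U) * diagonal d * Uᵀ := by
          simp only [Matrix.mul_assoc]
      _ = U * (diagonal (fun i => d i ^ j) * diagonal d) * Uᵀ := by
          rw [hU]; simp only [Matrix.mul_assoc, Matrix.one_mul]
      _ = _ := by rw [diagonal_mul_diagonal]; simp only [pow_succ]

lemma kb_quad (U : Matrix (Fin n) (Fin n) ℝ) (d v : Fin n → ℝ) :
    v ⬝ᵥ (U * diagonal d * Uᵀ) *ᵥ v = ∑ i, d i * (Uᵀ *ᵥ v) i ^ 2 := by
  rw [← mulVec_mulVec, ← mulVec_mulVec, dotProduct_mulVec, ← mulVec_transpose]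
  simp only [dotProduct, mulVec_diagonal]
  exact Finset.sum_congr rfl fun i _ => by ring

lemma kb_sq {U : Matrix (Fin n) (Fin n) ℝ} {d : Fin n → ℝ} (hU : Uᵀ * U = 1) (hd : ∀ i, 0 ≤ d i) :
    (U * diagonal (fun i => √(d i)) * Uᵀ) * (U * diagonal (fun i => √(d i)) * Uᵀ) =
      U * diagonal d * Uᵀ := by
  calc _ = U * diagonal (fun i => √(d i)) * (Uᵀ * U) * diagonal (fun i => √(d i)) * Uᵀ := by
          simp only [Matrix.mul_assoc]
      _ = U * (diagonal (fun i => √(d i)) * diagonal (fun i => √(d i))) * Uᵀ := by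
          rw [hU]; simp only [Matrix.mul_assoc, Matrix.one_mul]
      _ = _ := by 
        rw [diagonal_mul_diagonal]
        congr 3; ext i; exact Real.mul_self_sqrt (hd i)

lemma kb_symm (U : Matrix (Fin n) (Fin n) ℝ) (d : Fin n → ℝ) :
    (U * diagonal d * Uᵀ)ᵀ = U * diagonal d * Uᵀ := by
  simp [Matrix.mul_assoc]

lemma kb_form_bound {A U : Matrix (Fin n) (Fin n) ℝ} {d : Fin n → ℝ} (hU : Uᵀ * U = 1)
    (hU' : U * Uᵀ = 1) (hA : A = U * diagonal d * Uᵀ) (hd : ∀ i, 0 ≤ d i)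
    {Om : Matrix (Fin n) (Fin N) ℝ} {r : ℕ} {W : Matrix (Fin n) (Fin r) ℝ} (hW : Wᵀ * W = 1)
    (hK : colSpan W = krylov k A Om) (φ : Polynomial ℝ) (hdeg : φ.natDegree + 2 ≤ k)
    {φ0 lq l1 T2 : ℝ} (hφ0 : 0 < φ0) (hlq : 0 < lq) (hT2 : 0 ≤ T2)
    (h1 : ∀ i : Fin n, i.1 < q → lq ≤ d i ∧ φ0 ≤ φ.eval (d i))
    (h2 : ∀ i : Fin n, ¬ i.1 < q → d i ≤ l1 ∧ |φ.eval (d i)| ≤ 1)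
    (hgood : ∀ z : Fin n → ℝ, (Uᵀ * Om)ᵀ *ᵥ z = 0 →
      ∑ i, (if i.1 < q then z i ^ 2 else 0) ≤ T2 * ∑ i, (if i.1 < q then 0 else z i ^ 2))
    (v : Fin n → ℝ) (hv : (W * Wᵀ) *ᵥ v = 0) :
    v ⬝ᵥ A *ᵥ v ≤ (1 + T2 * (l1 / lq) * (φ0⁻¹) ^ 2) *
      ∑ i : Fin n, (if i.1 < q then 0 else d i) * (Uᵀ *ᵥ v) i ^ 2 := by
  set y := Uᵀ *ᵥ v with hy
  set z : Fin n → ℝ := fun i => (d i * φ.eval (d i)) * y i with hz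
  have hz0 : (Uᵀ * Om)ᵀ *ᵥ z = 0 := by
    have e0 : z = ∑ j ∈ Finset.range (φ.natDegree + 1),
        φ.coeff j • (diagonal (fun i => d i ^ (j + 1)) *ᵥ y) := by
      ext i
      rw [Finset.sum_apply, hz]
      simp only [Pi.smul_apply, mulVec_diagonal, smul_eq_mul, Polynomial.eval_eq_sum_range]
      rw [Finset.mul_sum, Finset.sum_mul]
      exact Finset.sum_congr rfl fun j _ => by ring
    rw [e0, ← Matrix.mulVecLin_apply, map_sum]
    apply Finset.sum_eq_zero
    intro j hj
    rw [map_smul, Matrix.mulVecLin_apply]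
    have h3 := kb_orth hW hK v hv (j + 1) (by have := Finset.mem_range.1 hj; omega)
    rw [kb_pow hU hU' hA] at h3
    have : (U * diagonal (fun i => d i ^ (j + 1)) * Uᵀ * Om)ᵀ *ᵥ v =
        (Uᵀ * Om)ᵀ *ᵥ (diagonal (fun i => d i ^ (j + 1)) *ᵥ y) := by
      rw [hy, mulVec_mulVec, mulVec_mulVec]
      simp only [transpose_mul, transpose_transpose, diagonal_transpose, Matrix.mul_assoc]
    rw [← this, h3, smul_zero]
  have hg := hgood z hz0
  rw [hA, kb_quad, ← hy]
  have split : ∑ i, d i * y i ^ 2 = (∑ i : Fin n, if i.1 < q then d i * y i ^ 2 else 0) +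
      ∑ i : Fin n, (if i.1 < q then 0 else d i) * y i ^ 2 := by
    rw [← Finset.sum_add_distrib]
    refine Finset.sum_congr rfl fun i _ => ?_
    split_ifs <;> simp
  have b1 : (lq * φ0 ^ 2) * (∑ i : Fin n, if i.1 < q then d i * y i ^ 2 else 0) ≤
      ∑ i : Fin n, (if i.1 < q then z i ^ 2 else 0) := by
    rw [Finset.mul_sum]
    refine Finset.sum_le_sum fun i _ => ?_
    split_ifs with hi
    · obtain ⟨ha, hb⟩ := h1 i hi
      have : z i ^ 2 = (d i * φ.eval (d i) ^ 2) * (d i * y i ^ 2) := by rw [hz]; ring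
      rw [this]
      refine mul_le_mul_of_nonneg_right ?_ (mul_nonneg (hd i) (sq_nonneg _))
      exact mul_le_mul ha (pow_le_pow_left₀ hφ0.le hb 2) (by positivity) (hd i)
    · simp
  have b2 : ∑ i : Fin n, (if i.1 < q then 0 else z i ^ 2) ≤
      l1 * ∑ i : Fin n, (if i.1 < q then 0 else d i) * y i ^ 2 := by
    rw [Finset.mul_sum]
    refine Finset.sum_le_sum fun i _ => ?_
    split_ifs with hi
    · simp
    · obtain ⟨ha, hb⟩ := h2 i hi
      have : z i ^ 2 = (d i * φ.eval (d i) ^ 2) * (d i * y i ^ 2) := by rw [hz]; ring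
      rw [this]
      refine mul_le_mul_of_nonneg_right ?_ (mul_nonneg (hd i) (sq_nonneg _))
      have : φ.eval (d i) ^ 2 ≤ 1 := by rw [← sq_abs]; exact pow_le_one₀ (abs_nonneg _) hb
      nlinarith [hd i]
  set S2 := ∑ i : Fin n, (if i.1 < q then 0 else d i) * y i ^ 2
  set S1 := ∑ i : Fin n, if i.1 < q then d i * y i ^ 2 else 0
  have hpos : 0 < lq * φ0 ^ 2 := by positivity
  have : S1 ≤ T2 * (l1 / lq) * (φ0⁻¹) ^ 2 * S2 := by
    have h5 : (lq * φ0 ^ 2) * S1 ≤ T2 * (l1 * S2) :=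
      b1.trans (hg.trans (mul_le_mul_of_nonneg_left b2 hT2))
    have h6 : T2 * (l1 / lq) * (φ0⁻¹) ^ 2 * S2 = T2 * (l1 * S2) / (lq * φ0 ^ 2) := by
      field_simp
    rw [h6, le_div_iff₀ hpos]; linarith
  rw [split]; linarith

lemma kb_det_diag {U : Matrix (Fin n) (Fin n) ℝ} {d : Fin n → ℝ} (hU' : U * Uᵀ = 1) (c : ℝ) :
    (1 + c • (U * diagonal d * Uᵀ)).det = ∏ i, (1 + c * d i) := by
  have : (1 + c • (U * diagonal d * Uᵀ)) = U * diagonal (fun i => 1 + c * d i) * Uᵀ := by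
    have e : diagonal (fun i => 1 + c * d i) = 1 + c • diagonal d := by
      ext i j; by_cases h : i = j <;> simp [h, one_apply, diagonal_apply]
    rw [e, Matrix.mul_add, Matrix.add_mul, Matrix.mul_one, hU']
    simp [Matrix.mul_assoc]
  rw [this, det_mul, det_mul, det_diagonal, det_transpose, mul_right_comm]
  have h1 : U.det * U.det = 1 := by
    have := congrArg det hU'; rwa [det_mul, det_transpose, det_one] at this
  rw [h1, one_mul]

lemma kb_traceLog_smul {lam : ℝ} (hlam : 0 < lam) (M : Matrix (Fin n) (Fin n) ℝ)
    (h : 0 < (1 + lam⁻¹ • M).det) :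
    traceLog (lam • 1 + M) = n * Real.log lam + Real.log (1 + lam⁻¹ • M).det := by
  unfold traceLog
  have : lam • 1 + M = lam • (1 + lam⁻¹ • M) := by
    rw [smul_add, smul_smul, mul_inv_cancel₀ hlam.ne', one_smul]
  rw [this, det_smul, Fintype.card_fin, Real.log_mul (by positivity) h.ne', Real.log_pow]

theorem kb_determ {A U : Matrix (Fin n) (Fin n) ℝ} {d : Fin n → ℝ} (hU : Uᵀ * U = 1)
    (hU' : U * Uᵀ = 1) (hA : A = U * diagonal d * Uᵀ) (hd : ∀ i, 0 ≤ d i)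
    {r : ℕ} {W : Matrix (Fin n) (Fin r) ℝ} (hW : Wᵀ * W = 1) {lam c : ℝ} (hlam : 0 < lam)
    (hc : 0 ≤ c)
    (h : ∀ v, (W * Wᵀ) *ᵥ v = 0 → v ⬝ᵥ A *ᵥ v ≤ (1 + c) *
      ∑ i : Fin n, (if i.1 < q then 0 else d i) * (Uᵀ *ᵥ v) i ^ 2) :
    0 ≤ traceLog (lam • 1 + A) - traceLog (lam • 1 + W * (Wᵀ * A * W) * Wᵀ) ∧
    traceLog (lam • 1 + A) - traceLog (lam • 1 + W * (Wᵀ * A * W) * Wᵀ) ≤ 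
      Real.log (∏ i : Fin n, (1 + lam⁻¹ * (1 + c) * (if i.1 < q then 0 else d i))) := by
  set P := W * Wᵀ with hPdef
  have hli : 0 < lam⁻¹ := inv_pos.2 hlam
  have hd2 : ∀ i : Fin n, 0 ≤ (if i.1 < q then 0 else d i) := by
    intro i; split_ifs; exacts [le_rfl, hd i]
  have hA' : lam⁻¹ • A = U * diagonal (fun i => lam⁻¹ * d i) * Uᵀ := by
    have : diagonal (fun i => lam⁻¹ * d i) = lam⁻¹ • diagonal d := by
      ext i j; by_cases h : i = j <;> simp [h]
    rw [this, hA]; simp [Matrix.mul_assoc]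
  have key := kb_det_proj (A := lam⁻¹ • A) (P := P)
    (S := U * diagonal (fun i => √(lam⁻¹ * d i)) * Uᵀ)
    (S2 := U * diagonal (fun i : Fin n => √(if i.1 < q then 0 else d i)) * Uᵀ)
    (kb_symm _ _)
    (by rw [hA']; exact kb_sq hU (fun i => mul_nonneg hli.le (hd i))) 
    (by rw [hPdef, transpose_mul, transpose_transpose])
    (by rw [hPdef, Matrix.mul_assoc, ← Matrix.mul_assoc Wᵀ, hW, Matrix.one_mul])
    (kb_symm _ _) (lam⁻¹ * (1 + c)) (by positivity)
    (by
      intro v hv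
      have h1 := h v hv
      have e : (U * diagonal (fun i : Fin n => √(if i.1 < q then 0 else d i)) * Uᵀ) *ᵥ v ⬝ᵥ
        (U * diagonal (fun i : Fin n => √(if i.1 < q then 0 else d i)) * Uᵀ) *ᵥ v =
        ∑ i : Fin n, (if i.1 < q then 0 else d i) * (Uᵀ *ᵥ v) i ^ 2 := by
        rw [dotProduct_mulVec, ← mulVec_transpose, kb_symm, mulVec_mulVec,
          kb_sq hU hd2, dotProduct_comm, kb_quad]
      rw [e, smul_mulVec, dotProduct_smul, smul_eq_mul, mul_assoc]
      exact mul_le_mul_of_nonneg_left h1 hli.le)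
  rw [kb_sq hU hd2, kb_det_diag hU'] at key
  obtain ⟨k1, k2, k3⟩ := key
  have e1 : lam⁻¹ • (W * (Wᵀ * A * W) * Wᵀ) = P * (lam⁻¹ • A) * P := by
    rw [hPdef]; simp [Matrix.mul_assoc]
  have hApos : 0 < (1 + lam⁻¹ • A).det := k1.trans_le k2
  rw [kb_traceLog_smul hlam A hApos, kb_traceLog_smul hlam _ (by rw [e1]; exact k1), e1]
  have hprod : 0 < ∏ i : Fin n, (1 + lam⁻¹ * (1 + c) * (if i.1 < q then 0 else d i)) := by
    apply Finset.prod_pos; intro i _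
    have := hd2 i
    positivity
  constructor
  · have := Real.log_le_log k1 k2
    linarith
  · have := Real.log_le_log hApos k3
    rw [Real.log_mul k1.ne' hprod.ne'] at this
    linarith

end Determ

section Cheb

lemma kb_cheb_mono (m : ℤ) {x y : ℝ} (hx : 1 ≤ x) (hxy : x ≤ y) :
    (Polynomial.Chebyshev.T ℝ m).eval x ≤ (Polynomial.Chebyshev.T ℝ m).eval y := by
  have hy := hx.trans hxy
  have ex : x = Real.cosh (Real.arcosh x) := (Real.cosh_arcosh hx).symm
  have ey : y = Real.cosh (Real.arcosh y) := (Real.cosh_arcosh hy).symm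
  rw [ex, ey, Polynomial.Chebyshev.T_real_cosh, Polynomial.Chebyshev.T_real_cosh, Real.cosh_le_cosh,
    abs_mul, abs_mul]
  refine mul_le_mul_of_nonneg_left ?_ (abs_nonneg _)
  rw [← Real.cosh_le_cosh, ← ex, ← ey]
  exact hxy

lemma kb_prod_split {n q : ℕ} (hqn : q < n) (f : Fin n → ℝ) :
    ∏ i : Fin n, (if i.1 < q then 1 else f i) =
      ∏ i : Fin (n - q), f ⟨q + i.1, by have := i.isLt; omega⟩ := by
  obtain ⟨m, rfl⟩ := Nat.exists_eq_add_of_lt hqn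
  have e : q + m + 1 - q = m + 1 := by omega
  have h1 : ∏ i : Fin (q + (m + 1)), (if i.1 < q then 1 else f i) =
      ∏ i : Fin (m + 1), f ⟨q + i.1, by have := i.isLt; omega⟩ := by
    rw [Fin.prod_univ_add]
    simp [Fin.natAdd]
  refine h1.trans ?_
  refine Fintype.prod_equiv (finCongr e.symm) _ _ fun i => ?_
  simp

theorem kb_assemble {n N q k : ℕ} (hq : 2 ≤ q) (hqn : q < n) (hk : 2 ≤ k)
    {A U : Matrix (Fin n) (Fin n) ℝ} {d : Fin n → ℝ} (hU : Uᵀ * U = 1)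
    (hU' : U * Uᵀ = 1) (hA : A = U * diagonal d * Uᵀ) (hanti : Antitone d) (hd : ∀ i, 0 ≤ d i)
    {Om : Matrix (Fin n) (Fin N) ℝ} {r : ℕ} {W : Matrix (Fin n) (Fin r) ℝ} (hW : Wᵀ * W = 1)
    (hK : colSpan W = krylov k A Om) {T2 lam lq l1 : ℝ} (hT2 : 0 ≤ T2) (hlam : 0 < lam)
    (elq : lq = d ⟨q - 1, by omega⟩) (el1 : l1 = d ⟨q, hqn⟩) (hlq : 0 < lq)
    (hgood : ∀ z : Fin n → ℝ, (Uᵀ * Om)ᵀ *ᵥ z = 0 →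
      ∑ i, (if i.1 < q then z i ^ 2 else 0) ≤ T2 * ∑ i, (if i.1 < q then 0 else z i ^ 2)) :
    0 ≤ traceLog (lam • 1 + A) - traceLog (lam • 1 + W * (Wᵀ * A * W) * Wᵀ) ∧
    traceLog (lam • 1 + A) - traceLog (lam • 1 + W * (Wᵀ * A * W) * Wᵀ) ≤
      traceLog ((1 : Matrix (Fin (n - q)) (Fin (n - q)) ℝ) +
        (T2 * (l1 / lq) * (((Polynomial.Chebyshev.T ℝ ((k : ℤ) - 2)).eval
          ((2 * lq - l1) / l1))⁻¹) ^ 2 * lam⁻¹) •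
          Matrix.diagonal (fun i : Fin (n - q) => d ⟨q + i.1, by have := i.isLt; omega⟩)) +
      traceLog ((1 : Matrix (Fin (n - q)) (Fin (n - q)) ℝ) +
        lam⁻¹ • Matrix.diagonal (fun i : Fin (n - q) => d ⟨q + i.1, by have := i.isLt; omega⟩)) := by
  have hl1 : 0 ≤ l1 := el1 ▸ hd _
  have hl1q : l1 ≤ lq := by
    rw [elq, el1]; exact hanti (by simp [Fin.le_def])
  have hb1 : ∀ i : Fin n, i.1 < q → lq ≤ d i := fun i hi => by
    rw [elq]; exact hanti (by rw [Fin.le_def]; simp; omega)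
  have hb2 : ∀ i : Fin n, ¬ i.1 < q → d i ≤ l1 := fun i hi => by
    rw [el1]; exact hanti (by rw [Fin.le_def]; simp; omega)
  set t0 := (Polynomial.Chebyshev.T ℝ ((k : ℤ) - 2)).eval ((2 * lq - l1) / l1) with ht0
  set c := T2 * (l1 / lq) * (t0⁻¹) ^ 2 with hc
  have hc0 : 0 ≤ c := by positivity
  have hform : ∀ v, (W * Wᵀ) *ᵥ v = 0 → v ⬝ᵥ A *ᵥ v ≤ (1 + c) *
      ∑ i : Fin n, (if i.1 < q then 0 else d i) * (Uᵀ *ᵥ v) i ^ 2 := by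
    intro v hv
    rcases hl1.eq_or_lt with h0 | h0
    · have := kb_form_bound hU hU' hA hd hW hK (1 : Polynomial ℝ) (by simpa using hk)
        (φ0 := 1) (lq := lq) (l1 := l1) one_pos hlq hT2
        (fun i hi => ⟨hb1 i hi, by simp⟩) (fun i hi => ⟨hb2 i hi, by simp⟩) hgood v hv
      rw [← h0] at this
      rw [hc, ← h0]
      simpa using this
    · have hx1 : 1 ≤ (2 * lq - l1) / l1 := by rw [le_div_iff₀ h0]; linarith
      have ev : ∀ x, ((Polynomial.Chebyshev.T ℝ ((k : ℤ) - 2)).comp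
          (Polynomial.C (2 / l1) * Polynomial.X - 1)).eval x =
          (Polynomial.Chebyshev.T ℝ ((k : ℤ) - 2)).eval ((2 * x - l1) / l1) := by
        intro x
        rw [Polynomial.eval_comp]
        congr 1
        simp
        field_simp
      refine kb_form_bound hU hU' hA hd hW hK ((Polynomial.Chebyshev.T ℝ ((k : ℤ) - 2)).comp
          (Polynomial.C (2 / l1) * Polynomial.X - 1)) ?_
        (lt_of_lt_of_le one_pos (Polynomial.Chebyshev.one_le_eval_T_real _ hx1)) hlq hT2
        (fun i hi => ⟨hb1 i hi, ?_⟩) (fun i hi => ⟨hb2 i hi, ?_⟩) hgood v hv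
      · rw [Polynomial.natDegree_comp, Polynomial.Chebyshev.natDegree_T]
        have : (Polynomial.C (2 / l1) * Polynomial.X - 1 : Polynomial ℝ).natDegree ≤ 1 := by
          refine (Polynomial.natDegree_sub_le _ _).trans (max_le ?_ (by simp))
          compute_degree
        have h2 : ((k : ℤ) - 2).natAbs = k - 2 := by omega
        rw [h2]
        have := Nat.mul_le_mul_left (k - 2) this
        omega
      · rw [ev]
        refine kb_cheb_mono _ hx1 ?_
        have := hb1 i hi
        gcongr
      · rw [ev]
        apply Polynomial.Chebyshev.abs_eval_T_real_le_one
        have := hb2 i hi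
        have := hd i
        rw [abs_le, le_div_iff₀ h0, div_le_iff₀ h0]
        constructor <;> linarith
  obtain ⟨g1, g2⟩ := kb_determ hU hU' hA hd hW hlam hc0 hform
  refine ⟨g1, g2.trans ?_⟩
  have hli : 0 < lam⁻¹ := inv_pos.2 hlam
  have e0 : ∀ i : Fin n, (1 + lam⁻¹ * (1 + c) * (if i.1 < q then 0 else d i)) =
      if i.1 < q then 1 else 1 + lam⁻¹ * (1 + c) * d i := by
    intro i; split_ifs <;> simp
  simp only [e0]
  rw [kb_prod_split hqn]
  have det1 : ∀ a : ℝ, traceLog ((1 : Matrix (Fin (n - q)) (Fin (n - q)) ℝ) + a •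
      Matrix.diagonal (fun i : Fin (n - q) => d ⟨q + i.1, by have := i.isLt; omega⟩)) =
      Real.log (∏ i : Fin (n - q), (1 + a * d ⟨q + i.1, by have := i.isLt; omega⟩)) := by
    intro a
    unfold traceLog
    rw [← diagonal_one, ← diagonal_smul, diagonal_add, det_diagonal]
    simp
  rw [det1, det1]
  have hdn : ∀ i : Fin (n - q), 0 ≤ d ⟨q + i.1, by have := i.isLt; omega⟩ := fun i => hd _
  have pos : ∀ a : ℝ, 0 ≤ a →
      0 < (∏ i : Fin (n - q), (1 + a * d ⟨q + i.1, by have := i.isLt; omega⟩)) := by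
    intro a ha
    refine Finset.prod_pos fun i _ => ?_
    have := mul_nonneg ha (hdn i)
    linarith
  rw [← Real.log_mul (pos _ (by positivity)).ne' (pos _ hli.le).ne', ← Finset.prod_mul_distrib]
  refine Real.log_le_log ?_ ?_
  · exact pos (lam⁻¹ * (1 + c)) (by positivity)
  · refine Finset.prod_le_prod (fun i _ => ?_) (fun i _ => ?_)
    · have := mul_nonneg (mul_nonneg hli.le (by linarith : (0:ℝ) ≤ 1 + c)) (hdn i)
      linarith
    · have h3 := hdn i
      generalize d ⟨q + i.1, _⟩ = x at h3
      have : 0 ≤ c * lam⁻¹ * x * (lam⁻¹ * x) := by positivity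
      nlinarith

end Cheb

section GaussMap
open MeasureTheory ProbabilityTheory

/-- `μ` has the characteristic functional of a standard Gaussian combination of the family `e`. -/
def KbStd {E : Type*} [NormedAddCommGroup E] [NormedSpace ℝ E] [MeasurableSpace E] {ι : Type*}
    [Fintype ι] (μ : Measure E) (e : ι → E) : Prop :=
  ∀ L : StrongDual ℝ E, charFunDual μ L = Complex.exp (-(((∑ i, (L (e i)) ^ 2 : ℝ) : ℂ) / 2))

lemma kb_std_real : KbStd (gaussianReal 0 1) (fun _ : Unit => (1 : ℝ)) := by
  intro L
  have hL : L = (L 1) • (1 : ℝ →L[ℝ] ℝ) := by ext; simp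
  rw [charFunDual_eq_charFun_map_one]
  have : (⇑L : ℝ → ℝ) = fun x => L 1 * x := by
    ext x
    have := L.map_smul x 1
    simp only [smul_eq_mul, mul_one] at this
    rw [this, mul_comm]
  rw [this, gaussianReal_map_const_mul, charFun_gaussianReal]
  simp

lemma kb_std_pi {E : Type*} [NormedAddCommGroup E] [NormedSpace ℝ E] [MeasurableSpace E]
    [BorelSpace E] [SecondCountableTopology E]
    {ι κ : Type*} [Fintype ι] [Fintype κ] [DecidableEq κ] {μ : Measure E} [IsProbabilityMeasure μ]
    {e : ι → E} (h : KbStd μ e) :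
    KbStd (Measure.pi fun _ : κ => μ) (fun i : κ × ι => (Pi.single i.1 (e i.2) : κ → E)) := by
  intro L
  rw [charFunDual_pi]
  simp only [h _]
  rw [← Complex.exp_sum]
  congr 1
  rw [Fintype.sum_prod_type]
  push_cast
  rw [Finset.sum_neg_distrib, Finset.sum_div]
  rfl

lemma kb_std_prod {E F : Type*} [NormedAddCommGroup E] [NormedSpace ℝ E] [MeasurableSpace E]
    [NormedAddCommGroup F] [NormedSpace ℝ F] [MeasurableSpace F] [BorelSpace E] [BorelSpace F]
    [SecondCountableTopology E] [SecondCountableTopology F]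
    {ι κ : Type*} [Fintype ι] [Fintype κ] {μ : Measure E} [IsProbabilityMeasure μ]
    {ν : Measure F} [IsProbabilityMeasure ν]
    {e : ι → E} {f : κ → F} (h : KbStd μ e) (h' : KbStd ν f) :
    KbStd (μ.prod ν) (Sum.elim (fun i => (e i, (0 : F))) (fun j => ((0 : E), f j))) := by
  intro L
  rw [charFunDual_prod, h, h', ← Complex.exp_add]
  congr 1
  simp
  ring

lemma kb_sum_sq {α : Type*} [Fintype α] (v : α → ℝ) : ∑ i, v i ^ 2 = v ⬝ᵥ v := by
  simp [dotProduct, sq]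

lemma kb_std_map {E F : Type*} [NormedAddCommGroup E] [NormedSpace ℝ E] [MeasurableSpace E]
    [NormedAddCommGroup F] [NormedSpace ℝ F] [MeasurableSpace F] [BorelSpace E] [BorelSpace F]
    [SecondCountableTopology E] [SecondCountableTopology F] [CompleteSpace F]
    {ι κ : Type*} [Fintype ι] [Fintype κ] [DecidableEq κ] {μ : Measure E} [IsProbabilityMeasure μ]
    {ν : Measure F} [IsProbabilityMeasure ν]
    {e : ι → E} {f : κ → F} (h : KbStd μ e) (h' : KbStd ν f) (T : E →L[ℝ] F)
    (V : Matrix κ ι ℝ) (hV : V * Vᵀ = 1) (hT : ∀ i, T (e i) = ∑ j, V j i • f j) :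
    MeasurePreserving T μ ν := by
  refine ⟨T.continuous.measurable, ?_⟩
  have : IsProbabilityMeasure (μ.map T) :=
    Measure.isProbabilityMeasure_map T.continuous.measurable.aemeasurable
  refine Measure.ext_of_charFunDual (funext fun L => ?_)
  rw [charFunDual_map, h, h']
  congr 4
  have e1 : ∀ i, (L.comp T) (e i) = (Vᵀ *ᵥ (fun j => L (f j))) i := by
    intro i
    simp only [ContinuousLinearMap.comp_apply, hT, map_sum, map_smul, smul_eq_mul]
    rfl
  simp only [e1]
  rw [kb_sum_sq, kb_sum_sq (fun j => L (f j)), dotProduct_mulVec, vecMul_transpose, mulVec_mulVec, hV, one_mulVec]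

/-- standard Gaussian on `ι → ℝ`. -/
noncomputable abbrev kbG (ι : Type*) [Fintype ι] : Measure (ι → ℝ) :=
  Measure.pi fun _ : ι => gaussianReal 0 1

/-- standard Gaussian on `κ → ι → ℝ`. -/
noncomputable abbrev kbM (κ ι : Type*) [Fintype κ] [Fintype ι] : Measure (κ → ι → ℝ) :=
  Measure.pi fun _ : κ => kbG ι

lemma kb_std_reindex {E : Type*} [NormedAddCommGroup E] [NormedSpace ℝ E] [MeasurableSpace E]
    {ι κ : Type*} [Fintype ι] [Fintype κ] {μ : Measure E} {e : ι → E} (h : KbStd μ e) (σ : κ ≃ ι) :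
    KbStd μ (e ∘ σ) := by
  intro L
  rw [h L]
  congr 4
  exact (Fintype.sum_equiv σ _ _ fun _ => rfl).symm

lemma kb_std_G (ι : Type*) [Fintype ι] [DecidableEq ι] :
    KbStd (kbG ι) (fun i : ι => (Pi.single i 1 : ι → ℝ)) :=
  kb_std_reindex (kb_std_pi (κ := ι) kb_std_real) (Equiv.prodPUnit ι).symm

lemma kb_std_M (κ ι : Type*) [Fintype κ] [Fintype ι] [DecidableEq κ] [DecidableEq ι] :
    KbStd (kbM κ ι) (fun i : κ × ι => (Pi.single i.1 (Pi.single i.2 1) : κ → ι → ℝ)) :=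
  kb_std_pi (E := ι → ℝ) (ι := ι) (κ := κ) (μ := kbG ι) (e := fun i : ι => (Pi.single i 1 : ι → ℝ))
    (kb_std_G ι)

variable {κ κ' ι ι' : Type*} [Fintype κ] [Fintype ι] [DecidableEq κ] [DecidableEq ι]
  [Fintype κ'] [Fintype ι'] [DecidableEq κ'] [DecidableEq ι']

lemma kb_dot_law {u : ι → ℝ} (hu : u ⬝ᵥ u = 1) :
    MeasurePreserving (fun g : ι → ℝ => g ⬝ᵥ u) (kbG ι) (gaussianReal 0 1) := by
  let T : (ι → ℝ) →ₗ[ℝ] ℝ :=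
    { toFun := fun g => g ⬝ᵥ u
      map_add' := fun a b => add_dotProduct a b u
      map_smul' := fun a b => by simp }
  refine kb_std_map (kb_std_G ι) kb_std_real T.toContinuousLinearMap (Matrix.of fun _ i => u i) ?_ ?_
  · ext i j
    simp [mul_apply]
    simpa [dotProduct] using hu
  · intro i
    simp [T]

lemma kb_mulVec_law {V : Matrix κ ι ℝ} (hV : V * Vᵀ = 1) :
    MeasurePreserving (fun h : ι → ℝ => V *ᵥ h) (kbG ι) (kbG κ) := by
  refine kb_std_map (kb_std_G ι) (kb_std_G κ) (LinearMap.toContinuousLinearMap V.mulVecLin) V hV ?_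
  intro i
  ext j
  simp [Pi.single_apply]

lemma kb_vecMul_law {u : κ → ℝ} (hu : u ⬝ᵥ u = 1) :
    MeasurePreserving (fun Y : κ → ι → ℝ => (Matrix.of Y)ᵀ *ᵥ u) (kbM κ ι) (kbG ι) := by
  let T : (κ → ι → ℝ) →ₗ[ℝ] (ι → ℝ) :=
    { toFun := fun Y => (Matrix.of Y)ᵀ *ᵥ u
      map_add' := fun a b => by
        rw [← add_mulVec]; rfl
      map_smul' := fun a b => by
        rw [RingHom.id_apply, ← smul_mulVec]; rfl }
  refine kb_std_map (kb_std_M κ ι) (kb_std_G ι) T.toContinuousLinearMap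
    (Matrix.of fun j i => if i.2 = j then u i.1 else 0) ?_ ?_
  · ext i j
    simp only [mul_apply, Fintype.sum_prod_type, transpose_apply, of_apply]
    rw [Finset.sum_comm, Finset.sum_eq_single i]
    · by_cases h : i = j
      · subst h; simpa [dotProduct] using hu
      · simp [h]
    · intro b _ hb; simp [hb]
    · simp
  · rintro ⟨i, j⟩
    ext l
    simp [T, mulVec, dotProduct, Pi.single_apply, ite_apply, ite_mul, eq_comm]

/-- rows of `Ω` rotated by an orthogonal matrix and split in two blocks. -/
lemma kb_split_law (σ : κ ⊕ κ' ≃ ι') {R : Matrix ι' ι' ℝ} (hR : R * Rᵀ = 1) :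
    MeasurePreserving (fun Ω : ι' → ι → ℝ =>
      ((fun i => (R * Matrix.of Ω) (σ (Sum.inl i)), fun i => (R * Matrix.of Ω) (σ (Sum.inr i))) :
        (κ → ι → ℝ) × (κ' → ι → ℝ))) (kbM ι' ι) ((kbM κ ι).prod (kbM κ' ι)) := by
  let T : (ι' → ι → ℝ) →ₗ[ℝ] (κ → ι → ℝ) × (κ' → ι → ℝ) :=
    { toFun := fun Ω => ((fun i => (R * Matrix.of Ω) (σ (Sum.inl i)),
        fun i => (R * Matrix.of Ω) (σ (Sum.inr i))))
      map_add' := fun a b => by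
        have : R * Matrix.of (a + b) = R * Matrix.of a + R * Matrix.of b := by
          rw [← Matrix.mul_add]; rfl
        rw [this]; rfl
      map_smul' := fun a b => by
        have : R * Matrix.of (a • b) = a • (R * Matrix.of b) := by
          rw [← Matrix.mul_smul]; rfl
        rw [this]; rfl }
  refine kb_std_map (kb_std_M ι' ι) (kb_std_prod (kb_std_M κ ι) (kb_std_M κ' ι))
    T.toContinuousLinearMap
    (Matrix.of fun j i => R (σ (Sum.map Prod.fst Prod.fst j)) i.1 * 
      if (Sum.elim Prod.snd Prod.snd j) = i.2 then 1 else 0) ?_ ?_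
  · ext i j
    have hR' : ∀ a b, ∑ c, R a c * R b c = if a = b then 1 else 0 := by
      intro a b
      have := congrFun (congrFun hR a) b
      simpa [mul_apply, one_apply] using this
    simp only [mul_apply, Fintype.sum_prod_type, transpose_apply, of_apply]
    have : ∀ c d, R (σ (Sum.map Prod.fst Prod.fst i)) c * 
        (if (Sum.elim Prod.snd Prod.snd i) = d then 1 else 0) *
        (R (σ (Sum.map Prod.fst Prod.fst j)) c * 
        (if (Sum.elim Prod.snd Prod.snd j) = d then 1 else 0)) =
        (R (σ (Sum.map Prod.fst Prod.fst i)) c * R (σ (Sum.map Prod.fst Prod.fst j)) c) *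
        ((if (Sum.elim Prod.snd Prod.snd i) = d then 1 else 0) *
          (if (Sum.elim Prod.snd Prod.snd j) = d then (1 : ℝ) else 0)) := by intros; ring
    simp only [this]
    have hs : ∀ a b : ι, ∑ d, (if a = d then (1 : ℝ) else 0) * (if b = d then (1 : ℝ) else 0) =
        if b = a then 1 else 0 := by
      intro a b
      simp [eq_comm]
    rw [← Finset.sum_mul_sum, hR', hs]
    rcases i with ⟨i, i'⟩ | ⟨i, i'⟩ <;> rcases j with ⟨j, j'⟩ | ⟨j, j'⟩ <;>
      simp [one_apply, Prod.ext_iff, ite_and, eq_comm] <;> split_ifs <;> rfl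
  · rintro ⟨i, j⟩
    ext a b
    · simp [T, mul_apply, Pi.single_apply, ite_apply, Fintype.sum_prod_type, Prod.fst_sum, 
        Finset.sum_apply, eq_comm]
    · simp [T, mul_apply, Pi.single_apply, ite_apply, Fintype.sum_prod_type, Prod.snd_sum, 
        Finset.sum_apply, eq_comm]

end GaussMap

section Analytic
open MeasureTheory ProbabilityTheory

lemma kb_lintegral_prod {d : ℕ} (μ : Fin d → Measure ℝ) [∀ i, SigmaFinite (μ i)]
    (f : Fin d → ℝ → ENNReal) (hf : ∀ i, Measurable (f i)) :
    ∫⁻ x, ∏ i, f i (x i) ∂(Measure.pi μ) = ∏ i, ∫⁻ x, f i x ∂(μ i) := by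
  induction d with
  | zero => simp
  | succ d ih =>
    have mp := (measurePreserving_piFinSuccAbove μ 0).symm
    rw [← mp.lintegral_comp_emb (MeasurableEquiv.measurableEmbedding _)]
    simp only [Fin.prod_univ_succ]
    have : ∀ a : ℝ × (Fin d → ℝ), f 0 ((MeasurableEquiv.piFinSuccAbove (fun _ => ℝ) 0).symm a 0) *
        ∏ i : Fin d, f i.succ ((MeasurableEquiv.piFinSuccAbove (fun _ => ℝ) 0).symm a i.succ) =
        f 0 a.1 * ∏ i : Fin d, f i.succ (a.2 i) := by
      intro a
      simp [MeasurableEquiv.piFinSuccAbove]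
    simp only [this]
    rw [lintegral_prod_mul (f := f 0) (g := fun x : Fin d → ℝ => ∏ i : Fin d, f i.succ (x i))
      (hf 0).aemeasurable
      (Finset.measurable_fun_prod _ fun i _ => (hf _).comp (measurable_pi_apply i)).aemeasurable]
    congr 1
    exact ih (fun j => μ j.succ) (fun j => f j.succ) (fun i => hf _)

lemma kb_G_density (d : ℕ) : kbG (Fin d) =
    volume.withDensity (fun x : Fin d → ℝ => ∏ i, gaussianPDF 0 1 (x i)) := by
  refine Measure.pi_eq fun s hs => ?_
  rw [withDensity_apply _ (MeasurableSet.univ_pi hs), ← lintegral_indicator (MeasurableSet.univ_pi hs)]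
  have : ∀ x : Fin d → ℝ, (Set.univ.pi s).indicator (fun x => ∏ i, gaussianPDF 0 1 (x i)) x =
      ∏ i, (s i).indicator (gaussianPDF 0 1) (x i) := by
    intro x
    by_cases hx : x ∈ Set.univ.pi s
    · rw [Set.indicator_of_mem hx]
      exact Finset.prod_congr rfl fun i _ => (Set.indicator_of_mem (hx i trivial) _).symm
    · rw [Set.indicator_of_notMem hx]
      simp only [Set.mem_pi, not_forall] at hx
      obtain ⟨i, _, hi⟩ := hx
      exact (Finset.prod_eq_zero (Finset.mem_univ i) (Set.indicator_of_notMem hi _)).symm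
  simp only [this]
  rw [volume_pi, kb_lintegral_prod _ _ fun i => (measurable_gaussianPDF 0 1).indicator (hs i)]
  refine Finset.prod_congr rfl fun i _ => ?_
  rw [lintegral_indicator (hs i), gaussianReal_apply _ one_ne_zero]

lemma kb_G_le (d : ℕ) (s : Set (Fin d → ℝ)) (hs : MeasurableSet s) :
    kbG (Fin d) s ≤ ENNReal.ofReal ((√(2 * Real.pi))⁻¹ ^ d) * volume s := by
  rw [kb_G_density, withDensity_apply _ hs, ← setLIntegral_const]
  refine lintegral_mono fun x => ?_
  rw [ENNReal.ofReal_pow (by positivity)]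
  refine (Finset.prod_le_pow_card _ _ (ENNReal.ofReal (√(2 * Real.pi))⁻¹) fun i _ => ?_).trans (by simp)
  unfold gaussianPDF
  refine ENNReal.ofReal_le_ofReal ?_
  unfold gaussianPDFReal
  simp only [NNReal.coe_one, mul_one]
  refine mul_le_of_le_one_right (by positivity) ?_
  rw [Real.exp_le_one_iff]
  have := sq_nonneg (x i - 0)
  linarith

lemma kb_smallball (r : ℕ) (hr : 0 < r) {t : ℝ} (ht : 0 < t) :
    kbG (Fin r) {x | x ⬝ᵥ x < t ^ 2} ≤
      ENNReal.ofReal (t ^ r / ((√2) ^ r * Real.Gamma (r / 2 + 1))) := by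
  have hne : Nonempty (Fin r) := ⟨⟨0, hr⟩⟩
  have hm : MeasurableSet {x : Fin r → ℝ | x ⬝ᵥ x < t ^ 2} := by
    apply measurableSet_lt _ measurable_const
    unfold dotProduct
    fun_prop
  have hv := volume_sum_rpow_lt (Fin r) (p := 2) (by norm_num) t
  have hset : {x : Fin r → ℝ | (∑ i, |x i| ^ (2:ℝ)) ^ (1 / (2:ℝ)) < t} = 
      {x : Fin r → ℝ | x ⬝ᵥ x < t ^ 2} := by
    ext x
    simp only [Set.mem_setOf_eq]
    rw [← Real.sqrt_eq_rpow, Real.sqrt_lt' ht]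
    simp [dotProduct, sq]
  rw [hset] at hv
  refine (kb_G_le r _ hm).trans ?_
  rw [hv, ← ENNReal.ofReal_pow ht.le, ← ENNReal.ofReal_mul (by positivity), 
    ← ENNReal.ofReal_mul (by positivity)]
  refine ENNReal.ofReal_le_ofReal (le_of_eq ?_)
  have hG : 2 * Real.Gamma (1 / 2 + 1) = √Real.pi := by
    rw [Real.Gamma_add_one (by norm_num), Real.Gamma_one_half_eq]; ring
  rw [hG, Fintype.card_fin, Real.sqrt_mul (by norm_num : (0:ℝ) ≤ 2)]
  have h1 : √Real.pi ≠ 0 := by positivity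
  have h2 : √(2:ℝ) ≠ 0 := by positivity
  have h3 : Real.Gamma (r / 2 + 1) ≠ 0 := (Real.Gamma_pos_of_pos (by positivity)).ne'
  rw [inv_pow, mul_pow]
  field_simp

end Analytic

section Moment
open MeasureTheory ProbabilityTheory

lemma kb_exp_moment {t : ℝ} (ht1 : t < 1 / 2) :
    ∫⁻ x, ENNReal.ofReal (Real.exp (t * x ^ 2)) ∂(gaussianReal 0 1) =
      ENNReal.ofReal ((√(1 - 2 * t))⁻¹) := by
  rw [gaussianReal_of_var_ne_zero _ one_ne_zero,
    lintegral_withDensity_eq_lintegral_mul _ (measurable_gaussianPDF 0 1) (by fun_prop)]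
  have hb : 0 < 1 / 2 - t := by linarith
  have : ∀ x : ℝ, (gaussianPDF 0 1 * fun x => ENNReal.ofReal (Real.exp (t * x ^ 2))) x =
      ENNReal.ofReal ((√(2 * Real.pi))⁻¹ * Real.exp (-(1 / 2 - t) * x ^ 2)) := by
    intro x
    rw [Pi.mul_apply, gaussianPDF, ← ENNReal.ofReal_mul (gaussianPDFReal_nonneg _ _ _)]
    congr 1
    unfold gaussianPDFReal
    simp only [NNReal.coe_one, mul_one]
    rw [mul_assoc, ← Real.exp_add]
    congr 2
    ring
  simp only [this]
  rw [← ofReal_integral_eq_lintegral_ofReal ((integrable_exp_neg_mul_sq hb).const_mul _)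
    (Filter.Eventually.of_forall fun x => by positivity), integral_const_mul, integral_gaussian]
  congr 1
  rw [← Real.sqrt_inv, ← Real.sqrt_inv, ← Real.sqrt_mul (by positivity)]
  congr 1
  have : 1 - 2 * t ≠ 0 := by linarith
  have : 1 / 2 - t ≠ 0 := by linarith
  have := Real.pi_pos.ne'
  field_simp

lemma kb_log_bound {x : ℝ} (hx : 0 ≤ x) : Real.log (1 + x) ≤ x * (2 + x) / (2 * (1 + x)) := by
  have hd : ∀ y : ℝ, 0 ≤ y → HasDerivAt (fun y : ℝ => y * (2 + y) / (2 * (1 + y)) - Real.log (1 + y))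
      ((1 / 2) * (1 - 1 / (1 + y)) ^ 2) y := by
    intro y hy
    have h1 : (1 + y) ≠ 0 := by positivity
    have ha : HasDerivAt (fun y : ℝ => 1 + y) 1 y := (hasDerivAt_id' y).const_add 1
    have hb : HasDerivAt (fun y : ℝ => y * (2 + y)) (1 * (2 + y) + y * 1) y :=
      (hasDerivAt_id' y).mul ((hasDerivAt_id' y).const_add 2)
    refine ((hb.div (ha.const_mul 2) (by positivity)).sub (ha.log h1)).congr_deriv ?_
    field_simp
    ring
  have hm : MonotoneOn (fun y : ℝ => y * (2 + y) / (2 * (1 + y)) - Real.log (1 + y)) (Set.Ici 0) := by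
    refine monotoneOn_of_deriv_nonneg (convex_Ici 0)
      (fun y hy => (hd y hy).continuousAt.continuousWithinAt)
      (fun y hy => ?_) (fun y hy => ?_)
    · rw [interior_Ici] at hy
      exact (hd y hy.le).differentiableAt.differentiableWithinAt
    · rw [interior_Ici] at hy
      rw [(hd y hy.le).deriv]
      positivity
  have := hm (Set.mem_Ici.2 le_rfl) (Set.mem_Ici.2 hx) hx
  simp at this
  linarith

lemma kb_moment_num {d r : ℝ} (hd : 1 ≤ d) (hr : 3 ≤ r) :
    r * Real.log (d + r) - r + d * Real.log ((d + r) / d) ≤ r * Real.log (d + r - 1) := by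
  have h1 : Real.log (d + r) - Real.log (d + r - 1) ≤ 1 / (d + r - 1) := by
    rw [← Real.log_div (by linarith) (by linarith)]
    have : (d + r) / (d + r - 1) = 1 + 1 / (d + r - 1) := by
      have : d + r - 1 ≠ 0 := by linarith
      field_simp; ring
    rw [this]
    have := Real.log_le_sub_one_of_pos (x := 1 + 1 / (d + r - 1)) (by
      have : 0 < 1 / (d + r - 1) := by apply one_div_pos.2; linarith
      linarith)
    linarith
  have h2 : d * Real.log ((d + r) / d) ≤ r - r * (r / (2 * (d + r))) := by
    have e : (d + r) / d = 1 + r / d := by field_simp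
    rw [e]
    have := kb_log_bound (x := r / d) (by positivity)
    refine (mul_le_mul_of_nonneg_left this (by linarith)).trans (le_of_eq ?_)
    have : d + r ≠ 0 := by linarith
    have : d ≠ 0 := by linarith
    field_simp
    ring
  have h3 : 1 / (d + r - 1) ≤ r / (2 * (d + r)) := by
    rw [div_le_div_iff₀ (by linarith) (by linarith)]
    nlinarith
  nlinarith [mul_le_mul_of_nonneg_left (h1.trans h3) (by linarith : 0 ≤ r)]

lemma kb_moment (d r : ℕ) (hd : 1 ≤ d) (hr : 3 ≤ r) :
    ∫⁻ g, ENNReal.ofReal (√(g ⬝ᵥ g) ^ r) ∂(kbG (Fin d)) ≤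
      ENNReal.ofReal (√((d : ℝ) + r - 1) ^ r) := by
  have hd' : (1 : ℝ) ≤ d := by exact_mod_cast hd
  have hr' : (3 : ℝ) ≤ r := by exact_mod_cast hr
  set t : ℝ := r / (2 * (d + r)) with ht
  have ht0 : 0 < t := by positivity
  have ht1 : t < 1 / 2 := by
    rw [ht, div_lt_div_iff₀ (by positivity) (by norm_num)]; linarith
  set K : ℝ := √((d + r) / Real.exp 1) with hK
  have pt : ∀ g : Fin d → ℝ, ENNReal.ofReal (√(g ⬝ᵥ g) ^ r) ≤
      ENNReal.ofReal (K ^ r) * ∏ i, ENNReal.ofReal (Real.exp (t * (g i) ^ 2)) := by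
    intro g
    rw [← ENNReal.ofReal_prod_of_nonneg (fun i _ => (Real.exp_pos _).le),
      ← ENNReal.ofReal_mul (by positivity)]
    refine ENNReal.ofReal_le_ofReal ?_
    rw [← Real.exp_sum, ← Finset.mul_sum, kb_sum_sq]
    have hx : 0 ≤ g ⬝ᵥ g := by rw [← kb_sum_sq]; positivity
    generalize g ⬝ᵥ g = x at hx
    have e : Real.exp (t * x) = Real.exp (t * x / r) ^ r := by
      rw [← Real.exp_nat_mul]; congr 1; field_simp
    rw [e, ← mul_pow]
    refine pow_le_pow_left₀ (by positivity) ?_ r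
    have e2 : Real.exp (t * x / r) = √(Real.exp (x / (d + r))) := by
      rw [Real.sqrt_eq_rpow, ← Real.exp_mul]
      congr 1
      rw [ht]; field_simp
    rw [e2, hK, ← Real.sqrt_mul (by positivity)]
    refine Real.sqrt_le_sqrt ?_
    have := Real.add_one_le_exp (x / (d + r) - 1)
    rw [Real.exp_sub] at this
    have h3 : x / (d + r) ≤ Real.exp (x / (d + r)) / Real.exp 1 := by linarith
    have h4 : (0:ℝ) < d + r := by positivity
    rw [div_le_iff₀ h4] at h3
    calc x ≤ _ := h3
      _ = _ := by ring
  refine (lintegral_mono pt).trans ?_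
  rw [lintegral_const_mul _ (by fun_prop), kb_lintegral_prod (fun _ => gaussianReal 0 1)
    (fun _ x => ENNReal.ofReal (Real.exp (t * x ^ 2))) (fun _ => by fun_prop)]
  simp only [kb_exp_moment ht1, Finset.prod_const, Finset.card_univ, Fintype.card_fin]
  rw [← ENNReal.ofReal_pow (by positivity), ← ENNReal.ofReal_mul (by positivity)]
  refine ENNReal.ofReal_le_ofReal ?_
  have e1 : 1 - 2 * t = d / (d + r) := by
    rw [ht]; field_simp; ring
  rw [e1]
  have hpos1 : (0:ℝ) < d + r := by positivity
  have hpos2 : (0:ℝ) < d + r - 1 := by linarith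
  have hpos3 : (0:ℝ) < d := by linarith
  have hdiv : (0:ℝ) < d / (d + r) := by positivity
  have hK0 : 0 < K := by positivity
  have hs0 : 0 < √((d:ℝ) / (d + r)) := by positivity
  have hs1 : 0 < √((d:ℝ) + r - 1) := Real.sqrt_pos.2 hpos2
  rw [← Real.log_le_log_iff (by positivity) (by positivity), Real.log_mul (by positivity) (by positivity),
    Real.log_pow, Real.log_pow, Real.log_pow, Real.log_inv, hK, Real.log_sqrt (by positivity),
    Real.log_sqrt hdiv.le, Real.log_sqrt hpos2.le, Real.log_div hpos1.ne' (Real.exp_pos 1).ne',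
    Real.log_exp, Real.log_div hpos3.ne' hpos1.ne']
  have := kb_moment_num hd' hr'
  rw [Real.log_div hpos1.ne' hpos3.ne'] at this
  linarith

end Moment

section Mills
open MeasureTheory ProbabilityTheory

lemma kb_gauss_half_integrable : Integrable (fun x : ℝ => Real.exp (-x ^ 2 / 2)) := by
  have := integrable_exp_neg_mul_sq (b := 1 / 2) (by norm_num)
  refine this.congr (Filter.Eventually.of_forall fun x => ?_)
  simp only []
  congr 1; ring

lemma kb_mills_integral (a : ℝ) :
    a / (1 + a ^ 2) * Real.exp (-a ^ 2 / 2) ≤ ∫ x in Set.Ioi a, Real.exp (-x ^ 2 / 2) := by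
  have hder : ∀ x : ℝ, HasDerivAt (fun x : ℝ => -(x / (1 + x ^ 2) * Real.exp (-x ^ 2 / 2)))
      ((1 - 2 / (1 + x ^ 2) ^ 2) * Real.exp (-x ^ 2 / 2)) x := by
    intro x
    have h0 : (1 + x ^ 2) ≠ 0 := by positivity
    have h1 : HasDerivAt (fun x : ℝ => 1 + x ^ 2) (2 * x) x := by
      simpa using (hasDerivAt_pow 2 x).const_add 1
    have h2 : HasDerivAt (fun x : ℝ => -x ^ 2 / 2) (-x) x := by
      have := ((hasDerivAt_pow 2 x).neg).div_const 2
      refine this.congr_deriv ?_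
      simp; ring
    refine ((((hasDerivAt_id' x).div h1 h0).mul h2.exp).neg).congr_deriv ?_
    simp only [Pi.div_apply]
    field_simp
    ring
  have hbd : ∀ x : ℝ, |1 - 2 / (1 + x ^ 2) ^ 2| ≤ 1 := by
    intro x
    have h1 : 0 < 2 / (1 + x ^ 2) ^ 2 := by positivity
    have h2 : 2 / (1 + x ^ 2) ^ 2 ≤ 2 := by
      apply div_le_self (by norm_num)
      nlinarith [sq_nonneg x, sq_nonneg (x ^ 2)]
    rw [abs_le]; constructor <;> linarith
  have hcont : Continuous fun x : ℝ => (1 - 2 / (1 + x ^ 2) ^ 2) * Real.exp (-x ^ 2 / 2) := by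
    have : ∀ x : ℝ, (1 + x ^ 2) ^ 2 ≠ 0 := fun x => by positivity
    fun_prop (disch := assumption)
  have hint : Integrable fun x : ℝ => (1 - 2 / (1 + x ^ 2) ^ 2) * Real.exp (-x ^ 2 / 2) := by
    refine kb_gauss_half_integrable.mono' hcont.aestronglyMeasurable
      (Filter.Eventually.of_forall fun x => ?_)
    rw [norm_mul, Real.norm_eq_abs, Real.norm_eq_abs, abs_of_pos (Real.exp_pos _)]
    exact mul_le_of_le_one_left (Real.exp_pos _).le (hbd x)
  have hlim : Filter.Tendsto (fun x : ℝ => -(x / (1 + x ^ 2) * Real.exp (-x ^ 2 / 2)))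
      Filter.atTop (nhds 0) := by
    have h1 : Filter.Tendsto (fun x : ℝ => Real.exp (-x ^ 2 / 2)) Filter.atTop (nhds 0) := by
      refine Real.tendsto_exp_atBot.comp ?_
      have : (fun x : ℝ => -x ^ 2 / 2) = fun x : ℝ => -(x ^ 2 / 2) := by ext; ring
      rw [this, Filter.tendsto_neg_atBot_iff]
      exact (Filter.tendsto_pow_atTop two_ne_zero).atTop_div_const (by norm_num)
    refine squeeze_zero_norm (fun x => ?_) h1
    rw [norm_neg, norm_mul, Real.norm_eq_abs, Real.norm_eq_abs, abs_of_pos (Real.exp_pos _)]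
    refine mul_le_of_le_one_left (Real.exp_pos _).le ?_
    rw [abs_div, div_le_one (by positivity), abs_of_pos (by positivity : 0 < 1 + x ^ 2)]
    have := sq_abs x
    nlinarith [sq_nonneg (|x| - 1), abs_nonneg x]
  have := integral_Ioi_of_hasDerivAt_of_tendsto' (a := a) (fun x _ => hder x) hint.integrableOn hlim
  have e : a / (1 + a ^ 2) * Real.exp (-a ^ 2 / 2) =
      ∫ x in Set.Ioi a, (1 - 2 / (1 + x ^ 2) ^ 2) * Real.exp (-x ^ 2 / 2) := by
    rw [this]; ring
  rw [e]
  refine integral_mono hint.integrableOn kb_gauss_half_integrable.integrableOn fun x => ?_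
  exact mul_le_of_le_one_left (Real.exp_pos _).le ((le_abs_self _).trans (hbd x))

lemma kb_mills {a : ℝ} (ha : 0 < a) :
    ENNReal.ofReal (√(2 / Real.pi) * (a / (1 + a ^ 2)) * Real.exp (-a ^ 2 / 2)) ≤
      gaussianReal 0 1 {z | a < |z|} := by
  have e0 : {z : ℝ | a < |z|} = Set.Ioi a ∪ Set.Iio (-a) := by
    ext z
    simp only [Set.mem_setOf_eq, Set.mem_union, Set.mem_Ioi, Set.mem_Iio, lt_abs]
    constructor <;> rintro (h | h) <;> [left; right; left; right] <;> linarith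
  have hdis : Disjoint (Set.Ioi a) (Set.Iio (-a)) := by
    rw [Set.disjoint_left]
    intro x h1 h2
    simp at h1 h2
    linarith
  have e1 : gaussianReal 0 1 (Set.Iio (-a)) = gaussianReal 0 1 (Set.Ioi a) := by
    have h := gaussianReal_map_neg (μ := 0) (v := 1)
    rw [neg_zero] at h
    conv_lhs => rw [← h]
    rw [Measure.map_apply measurable_neg measurableSet_Iio]
    congr 1
    ext x
    simp
  have e2 : gaussianReal 0 1 (Set.Ioi a) =
      ENNReal.ofReal ((√(2 * Real.pi))⁻¹ * ∫ x in Set.Ioi a, Real.exp (-x ^ 2 / 2)) := by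
    rw [gaussianReal_apply _ one_ne_zero, ← integral_const_mul,
      ofReal_integral_eq_lintegral_ofReal ((kb_gauss_half_integrable.const_mul _).integrableOn)
        (Filter.Eventually.of_forall fun x => by positivity)]
    refine lintegral_congr fun x => ?_
    simp [gaussianPDF, gaussianPDFReal]
  rw [e0, measure_union hdis measurableSet_Iio, e1, e2, ← two_mul, 
    ← ENNReal.ofReal_ofNat, ← ENNReal.ofReal_mul (by norm_num)]
  refine ENNReal.ofReal_le_ofReal ?_
  have h := kb_mills_integral a
  have hs : √(2 / Real.pi) = 2 * (√(2 * Real.pi))⁻¹ := by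
    rw [← Real.sqrt_inv, show (2:ℝ) = √(2 ^ 2) by simp, ← Real.sqrt_mul (by positivity)]
    congr 1
    simp
    field_simp
  rw [hs, mul_assoc, mul_assoc]
  gcongr

lemma kb_gamma {x : ℝ} (hx : 0 < x) :
    √(Real.pi / 2) * √x * (x ^ x * Real.exp (-x)) ≤ Real.Gamma (x + 1) := by
  rw [Real.Gamma_eq_integral (by linarith)]
  have hb : 0 < 1 / (2 * x) := by positivity
  have e1 : ∫ t in Set.Ioi x, x ^ x * Real.exp (-x) * Real.exp (-(1 / (2 * x)) * (t - x) ^ 2) =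
      √(Real.pi / 2) * √x * (x ^ x * Real.exp (-x)) := by
    rw [integral_const_mul]
    have h2 : ∫ t in Set.Ioi x, Real.exp (-(1 / (2 * x)) * (t - x) ^ 2) =
        ∫ u in Set.Ioi (0:ℝ), Real.exp (-(1 / (2 * x)) * u ^ 2) := by
      rw [← integral_indicator measurableSet_Ioi, ← integral_indicator measurableSet_Ioi,
        ← integral_sub_right_eq_self
          (fun u => (Set.Ioi (0:ℝ)).indicator (fun u => Real.exp (-(1 / (2 * x)) * u ^ 2)) u) x]
      refine integral_congr_ae (Filter.Eventually.of_forall fun t => ?_)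
      simp only [Set.indicator_apply, Set.mem_Ioi, sub_pos]
    rw [h2, integral_gaussian_Ioi, mul_comm]
    congr 1
    rw [← Real.sqrt_mul (by positivity), show √(Real.pi / (1 / (2 * x))) / 2 =
      √(Real.pi / (1 / (2 * x))) / √(2 ^ 2) by simp, ← Real.sqrt_div (by positivity)]
    congr 1
    field_simp
  rw [← e1]
  have hint := Real.GammaIntegral_convergent (s := x + 1) (by linarith)
  refine le_trans ?_ (setIntegral_mono_set hint ?_ (Set.Ioi_subset_Ioi hx.le).eventuallyLE)
  · refine setIntegral_mono_on ?_ (hint.mono_set (Set.Ioi_subset_Ioi hx.le)) measurableSet_Ioi ?_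
    · have := (integrable_exp_neg_mul_sq hb).comp_sub_right x
      exact (this.const_mul _).integrableOn
    · intro t ht
      have ht' : x < t := ht
      have ht0 : 0 < t := hx.trans ht'
      rw [add_sub_cancel_right, Real.rpow_def_of_pos hx, Real.rpow_def_of_pos ht0, ← Real.exp_add,
        ← Real.exp_add, ← Real.exp_add]
      refine Real.exp_le_exp.2 ?_
      set y := (t - x) / x with hy
      have hy0 : 0 ≤ y := div_nonneg (by linarith) hx.le
      have et : t = x * (1 + y) := by rw [hy]; field_simp; ring
      have h3 : y - y ^ 2 / 2 ≤ Real.log (1 + y) := by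
        refine le_trans ?_ (Real.le_log_one_add_of_nonneg hy0)
        rw [le_div_iff₀ (by linarith)]
        nlinarith [pow_nonneg hy0 3]
      have h4 : Real.log t = Real.log x + Real.log (1 + y) := by
        rw [et, Real.log_mul hx.ne' (by linarith)]
      rw [h4]
      have h5 : -(1 / (2 * x)) * (t - x) ^ 2 = - x * (y ^ 2 / 2) := by
        rw [et]; field_simp; ring
      rw [h5]
      have h6 : t = x + x * y := by rw [et]; ring
      rw [h6]
      nlinarith
  · refine (ae_restrict_iff' measurableSet_Ioi).2 (Filter.Eventually.of_forall fun t ht => ?_)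
    have : (0:ℝ) < t := ht
    simp only [Pi.zero_apply]
    positivity

lemma kb_const {r : ℕ} (hr : 3 ≤ r) :
    ((r : ℝ) / Real.exp 1) ^ r / ((√2) ^ r * Real.Gamma (r / 2 + 1)) ≤
      2 * (√(r : ℝ)) ^ r *
        (√(2 / Real.pi) * (√(r : ℝ) / (1 + √(r : ℝ) ^ 2)) * Real.exp (-√(r : ℝ) ^ 2 / 2)) := by
  have hr' : (3:ℝ) ≤ r := by exact_mod_cast hr
  have hr0 : (0:ℝ) < r := by linarith
  have hG := kb_gamma (x := (r:ℝ) / 2) (by positivity)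
  have hGp : 0 < Real.Gamma ((r:ℝ) / 2 + 1) := Real.Gamma_pos_of_pos (by positivity)
  have hsq : √(r:ℝ) ^ 2 = r := Real.sq_sqrt hr0.le
  rw [div_le_iff₀ (by positivity), hsq]
  have hp : ((r:ℝ) / 2) ^ ((r:ℝ) / 2) = √((r:ℝ) / 2) ^ r := by
    rw [Real.sqrt_eq_rpow, ← Real.rpow_natCast, ← Real.rpow_mul (by positivity)]
    congr 1; ring
  rw [hp] at hG
  have h2 : √2 ^ r * √((r:ℝ) / 2) ^ r = √(r:ℝ) ^ r := by
    rw [← mul_pow, ← Real.sqrt_mul (by norm_num)]; congr 2; ring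
  have he : Real.exp (-(r:ℝ) / 2) * Real.exp (-((r:ℝ) / 2)) = (Real.exp 1 ^ r)⁻¹ := by
    rw [← Real.exp_add, ← Real.exp_nat_mul, ← Real.exp_neg]; congr 1; ring
  have hpp : √(2 / Real.pi) * √(Real.pi / 2) = 1 := by
    rw [← Real.sqrt_mul (by positivity)]
    have : 2 / Real.pi * (Real.pi / 2) = 1 := by field_simp
    rw [this, Real.sqrt_one]
  have hss : √(r:ℝ) * √((r:ℝ) / 2) = r / √2 := by
    rw [Real.sqrt_div hr0.le, ← mul_div_assoc, Real.mul_self_sqrt hr0.le]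
  have hs2 : √(2:ℝ) * √2 = 2 := Real.mul_self_sqrt (by norm_num)
  have hs2' : (1.4 : ℝ) ≤ √2 := Real.le_sqrt_of_sq_le (by norm_num)
  calc ((r : ℝ) / Real.exp 1) ^ r ≤ (r:ℝ) ^ r * (Real.exp 1 ^ r)⁻¹ * (√2 * (r / (1 + r))) := by
        rw [div_pow, ← div_eq_mul_inv]
        refine le_mul_of_one_le_right (by positivity) ?_
        rw [← mul_div_assoc, le_div_iff₀ (by positivity)]
        nlinarith
    _ = 2 * √(r:ℝ) ^ r * (√(2 / Real.pi) * (√(r : ℝ) / (1 + r)) * Real.exp (-(r:ℝ) / 2)) *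
        (√2 ^ r * (√(Real.pi / 2) * √((r:ℝ) / 2) * (√((r:ℝ) / 2) ^ r * Real.exp (-((r:ℝ) / 2))))) := by
        have : 2 * √(r:ℝ) ^ r * (√(2 / Real.pi) * (√(r : ℝ) / (1 + r)) * Real.exp (-(r:ℝ) / 2)) *
            (√2 ^ r * (√(Real.pi / 2) * √((r:ℝ) / 2) * (√((r:ℝ) / 2) ^ r * Real.exp (-((r:ℝ) / 2)))))
            = 2 * √(r:ℝ) ^ r * (√2 ^ r * √((r:ℝ) / 2) ^ r) * (√(2 / Real.pi) * √(Real.pi / 2)) *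
              (√(r:ℝ) * √((r:ℝ) / 2)) / (1 + r) * 
              (Real.exp (-(r:ℝ) / 2) * Real.exp (-((r:ℝ) / 2))) := by ring
        rw [this, h2, he, hpp, hss]
        have h7 : √(r:ℝ) ^ r * √(r:ℝ) ^ r = (r:ℝ) ^ r := by
          rw [← mul_pow, Real.mul_self_sqrt hr0.le]
        have h8 : √2 = 2 / √2 := by field_simp; linarith
        rw [← h7]
        nth_rewrite 1 [h8]
        ring
    _ ≤ _ := by gcongr

end Mills

section SmallX
open MeasureTheory ProbabilityTheory

lemma kb_rows {q' : ℕ} (u : Fin (1 + q') → ℝ) (hu : u ⬝ᵥ u = 1) :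
    ∃ R : Matrix (Fin (1 + q')) (Fin (1 + q')) ℝ, R * Rᵀ = 1 ∧
      R (finSumFinEquiv (Sum.inl (0 : Fin 1))) = u := by
  classical
  set i0 : Fin (1 + q') := finSumFinEquiv (Sum.inl (0 : Fin 1)) with hi0
  let v : Fin (1 + q') → EuclideanSpace ℝ (Fin (1 + q')) := fun _ => WithLp.toLp 2 u
  have hv : Orthonormal ℝ (({i0} : Set (Fin (1 + q'))).domRestrict v) := by
    constructor
    · intro i
      have : ‖WithLp.toLp 2 u‖ ^ 2 = 1 := by
        rw [EuclideanSpace.norm_sq_eq]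
        simp only [Real.norm_eq_abs, sq_abs]
        rw [← hu, kb_sum_sq]
      have h2 : ‖WithLp.toLp 2 u‖ = 1 := by
        have h3 := norm_nonneg (WithLp.toLp 2 u)
        nlinarith
      exact h2
    · intro i j hij
      exact absurd (Subsingleton.elim i j) hij
  obtain ⟨b, hb⟩ := hv.exists_orthonormalBasis_extension_of_card_eq (by simp)
  refine ⟨Matrix.of fun i j => b i j, ?_, ?_⟩
  · ext i j
    have := b.orthonormal
    rw [orthonormal_iff_ite] at this
    have h := this i j
    rw [Matrix.mul_apply, Matrix.one_apply, ← h]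
    simp [PiLp.inner_apply, mul_comm]
  · have := hb i0 rfl
    ext j
    simp [this, v]

lemma kb_kill {q' N r : ℕ} (Z : Fin q' → Fin N → ℝ) (h : q' + r ≤ N) :
    ∃ Q : Matrix (Fin r) (Fin N) ℝ, Q * Qᵀ = 1 ∧ ∀ i, Q *ᵥ Z i = 0 := by
  classical
  let S : Submodule ℝ (EuclideanSpace ℝ (Fin N)) :=
    Submodule.span ℝ (Set.range fun i => WithLp.toLp 2 (Z i))
  have h1 : Module.finrank ℝ S ≤ q' := by
    have := finrank_range_le_card (R := ℝ) (fun i => WithLp.toLp 2 (Z i))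
    simpa [S, Set.finrank] using this
  have h2 : Module.finrank ℝ S + Module.finrank ℝ Sᗮ = N := by
    have := S.finrank_add_finrank_orthogonal
    simpa using this
  let b := stdOrthonormalBasis ℝ Sᗮ
  let f : Fin r → Fin (Module.finrank ℝ Sᗮ) := Fin.castLE (by omega)
  have hf : Function.Injective f := Fin.castLE_injective _
  refine ⟨Matrix.of fun i j => (b (f i) : EuclideanSpace ℝ (Fin N)) j, ?_, ?_⟩
  · ext i j
    have := b.orthonormal
    rw [orthonormal_iff_ite] at this
    have h := this (f i) (f j)
    rw [Matrix.mul_apply, Matrix.one_apply]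
    simp only [hf.eq_iff] at h
    rw [← h]
    change _ = inner ℝ (b (f i) : EuclideanSpace ℝ (Fin N)) (b (f j) : EuclideanSpace ℝ (Fin N))
    rw [PiLp.inner_apply]
    refine Finset.sum_congr rfl fun l _ => ?_
    exact mul_comm _ _
  · intro i
    ext j
    have hm : WithLp.toLp 2 (Z i) ∈ S := Submodule.subset_span ⟨i, rfl⟩
    have := (Submodule.mem_orthogonal S _).1 (b (f j)).2 _ hm
    simp only [PiLp.inner_apply] at this
    simp only [Matrix.mulVec, dotProduct, Matrix.of_apply, Pi.zero_apply]
    rw [← this]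
    exact Finset.sum_congr rfl fun l _ => rfl

lemma kb_contr {r N : ℕ} (Q : Matrix (Fin r) (Fin N) ℝ) (hQ : Q * Qᵀ = 1) (y : Fin N → ℝ) :
    (Q *ᵥ y) ⬝ᵥ (Q *ᵥ y) ≤ y ⬝ᵥ y := by
  have h : 0 ≤ (y - Qᵀ *ᵥ (Q *ᵥ y)) ⬝ᵥ (y - Qᵀ *ᵥ (Q *ᵥ y)) := by
    rw [← kb_sum_sq]; positivity
  have e1 : y ⬝ᵥ (Qᵀ *ᵥ (Q *ᵥ y)) = (Q *ᵥ y) ⬝ᵥ (Q *ᵥ y) := by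
    rw [Matrix.dotProduct_mulVec, Matrix.vecMul_transpose]
  have e2 : (Qᵀ *ᵥ (Q *ᵥ y)) ⬝ᵥ (Qᵀ *ᵥ (Q *ᵥ y)) = (Q *ᵥ y) ⬝ᵥ (Q *ᵥ y) := by
    rw [Matrix.dotProduct_mulVec, Matrix.vecMul_transpose, Matrix.mulVec_mulVec, hQ,
      Matrix.one_mulVec]
  rw [sub_dotProduct, dotProduct_sub, dotProduct_sub, dotProduct_comm (Qᵀ *ᵥ (Q *ᵥ y)) y, e1, e2] at h
  linarith

/-- the basic open event -/
def kbE {q N : ℕ} (s : ℝ) : Set ((Fin q → ℝ) × (Fin q → Fin N → ℝ)) :=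
  {P | ∃ w : Fin q → ℝ,
    s ^ 2 * (((Matrix.of P.2)ᵀ *ᵥ w) ⬝ᵥ ((Matrix.of P.2)ᵀ *ᵥ w)) < (P.1 ⬝ᵥ w) ^ 2}

lemma kbE_open {q N : ℕ} (s : ℝ) : IsOpen (kbE (q := q) (N := N) s) := by
  have : kbE (q := q) (N := N) s = ⋃ w : Fin q → ℝ, {P | 
    s ^ 2 * (((Matrix.of P.2)ᵀ *ᵥ w) ⬝ᵥ ((Matrix.of P.2)ᵀ *ᵥ w)) < (P.1 ⬝ᵥ w) ^ 2} := by
    ext P; simp [kbE]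
  rw [this]
  refine isOpen_iUnion fun w => isOpen_lt ?_ ?_
  · simp only [Matrix.mulVec, dotProduct, Matrix.transpose_apply, Matrix.of_apply]
    fun_prop
  · simp only [dotProduct]
    fun_prop

lemma kb_smallX {q N r : ℕ} (hr : 0 < r) (h : q + r = N + 1) (g : Fin q → ℝ) {s : ℝ}
    (hs : 0 < s) :
    kbM (Fin q) (Fin N) {X | (g, X) ∈ kbE s} ≤
      ENNReal.ofReal ((√(g ⬝ᵥ g) / s) ^ r / ((√2) ^ r * Real.Gamma (r / 2 + 1))) := by
  by_cases hg : g = 0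
  · have : {X : Fin q → Fin N → ℝ | (g, X) ∈ kbE s} = ∅ := by
      ext X
      simp only [kbE, Set.mem_setOf_eq, Set.mem_empty_iff_false, iff_false, not_exists, not_lt, hg,
        zero_dotProduct]
      intro w
      have : 0 ≤ ((Matrix.of X)ᵀ *ᵥ w) ⬝ᵥ ((Matrix.of X)ᵀ *ᵥ w) := by
        rw [← kb_sum_sq]; positivity
      have h2 := mul_nonneg (sq_nonneg s) this
      simpa using h2
    rw [this]; simp
  have hq0 : q ≠ 0 := by
    rintro rfl
    exact hg (Subsingleton.elim _ _)
  obtain ⟨q', rfl⟩ : ∃ q', q = 1 + q' := ⟨q - 1, by omega⟩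
  have hgg : 0 < g ⬝ᵥ g := by
    rcases (show 0 ≤ g ⬝ᵥ g by rw [← kb_sum_sq]; positivity).lt_or_eq with h | h
    · exact h
    · exact absurd (dotProduct_self_eq_zero.1 h.symm) hg
  set c := √(g ⬝ᵥ g) with hc
  have hc0 : 0 < c := Real.sqrt_pos.2 hgg
  have hcc : c * c = g ⬝ᵥ g := Real.mul_self_sqrt hgg.le
  obtain ⟨R, hR, hR0⟩ := kb_rows (c⁻¹ • g) (by
    rw [smul_dotProduct, dotProduct_smul, ← hcc]; simp; field_simp)
  have hR' : Rᵀ * R = 1 := mul_eq_one_comm.1 hR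
  have key := kb_split_law (ι := Fin N) (finSumFinEquiv (m := 1) (n := q')) hR
  set F := fun Ω : Fin (1 + q') → Fin N → ℝ =>
    ((fun i => (R * Matrix.of Ω) (finSumFinEquiv (Sum.inl i)),
      fun i => (R * Matrix.of Ω) (finSumFinEquiv (Sum.inr i))) :
      (Fin 1 → Fin N → ℝ) × (Fin q' → Fin N → ℝ)) with hF
  let D : Set ((Fin 1 → Fin N → ℝ) × (Fin q' → Fin N → ℝ)) :=
    {P | ∃ a : ℝ, ∃ w : Fin q' → ℝ,
      s ^ 2 * ((a • P.1 0 + (Matrix.of P.2)ᵀ *ᵥ w) ⬝ᵥ (a • P.1 0 + (Matrix.of P.2)ᵀ *ᵥ w)) <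
        (c * a) ^ 2}
  have hDm : MeasurableSet D := by
    have : D = ⋃ a : ℝ, ⋃ w : Fin q' → ℝ, {P | 
      s ^ 2 * ((a • P.1 0 + (Matrix.of P.2)ᵀ *ᵥ w) ⬝ᵥ (a • P.1 0 + (Matrix.of P.2)ᵀ *ᵥ w)) <
        (c * a) ^ 2} := by
      ext P; simp [D]
    rw [this]
    refine (isOpen_iUnion fun a => isOpen_iUnion fun w => isOpen_lt ?_ ?_).measurableSet
    · simp only [Matrix.mulVec, dotProduct, Matrix.transpose_apply, Matrix.of_apply, Pi.add_apply,
        Pi.smul_apply, smul_eq_mul]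
      fun_prop
    · fun_prop
  have hsub : {X : Fin (1 + q') → Fin N → ℝ | (g, X) ∈ kbE s} ⊆ F ⁻¹' D := by
    rintro X ⟨w, hw⟩
    refine ⟨(R *ᵥ w) (finSumFinEquiv (Sum.inl 0)), fun i => (R *ᵥ w) (finSumFinEquiv (Sum.inr i)), ?_⟩
    have e1 : c * (R *ᵥ w) (finSumFinEquiv (Sum.inl 0)) = g ⬝ᵥ w := by
      simp only [Matrix.mulVec, hR0, smul_dotProduct, smul_eq_mul]
      field_simp
    have e2 : (R *ᵥ w) (finSumFinEquiv (Sum.inl 0)) • (F X).1 0 +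
        (Matrix.of (F X).2)ᵀ *ᵥ (fun i => (R *ᵥ w) (finSumFinEquiv (Sum.inr i))) =
        (Matrix.of X)ᵀ *ᵥ w := by
      have : (Matrix.of X)ᵀ *ᵥ w = (R * Matrix.of X)ᵀ *ᵥ (R *ᵥ w) := by
        rw [Matrix.mulVec_mulVec, Matrix.transpose_mul, Matrix.mul_assoc, hR', Matrix.mul_one]
      rw [this]
      simp only [hF]
      generalize R *ᵥ w = v
      generalize R * Matrix.of X = M
      ext j
      simp only [Matrix.mulVec, dotProduct, Matrix.transpose_apply, Pi.add_apply,
        Pi.smul_apply, smul_eq_mul, Matrix.of_apply]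
      rw [← (finSumFinEquiv (m := 1) (n := q')).sum_comp, Fintype.sum_sum_type]
      simp only [Fin.isValue, Finset.univ_unique, Fin.default_eq_zero, Finset.sum_singleton]
      ring
    rw [e1, e2]
    exact hw
  refine (measure_mono hsub).trans ?_
  rw [key.measure_preimage hDm.nullMeasurableSet, Measure.prod_apply_symm hDm]
  have hb : ∀ Z : Fin q' → Fin N → ℝ, kbM (Fin 1) (Fin N) ((fun x => (x, Z)) ⁻¹' D) ≤
      ENNReal.ofReal ((c / s) ^ r / ((√2) ^ r * Real.Gamma (r / 2 + 1))) := by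
    intro Z
    obtain ⟨Q, hQ, hQZ⟩ := kb_kill Z (r := r) (by omega)
    have l1 := kb_vecMul_law (κ := Fin 1) (ι := Fin N) (u := fun _ => 1) (by simp [dotProduct])
    have l2 := (kb_mulVec_law hQ).comp l1
    refine le_trans ?_ (kb_smallball r hr (t := c / s) (by positivity))
    have hm : MeasurableSet {x : Fin r → ℝ | x ⬝ᵥ x < (c / s) ^ 2} := by
      refine (isOpen_lt ?_ continuous_const).measurableSet
      simp only [dotProduct]; fun_prop
    rw [← l2.measure_preimage hm.nullMeasurableSet]
    refine measure_mono ?_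
    rintro x ⟨a, w, hw⟩
    have e1 : ((Matrix.of x)ᵀ *ᵥ fun _ => 1) = x 0 := by
      ext j; simp [Matrix.mulVec, dotProduct]
    simp only [Set.mem_preimage, Function.comp_apply, Set.mem_setOf_eq, e1]
    have e2 : Q *ᵥ (a • x 0 + (Matrix.of Z)ᵀ *ᵥ w) = a • (Q *ᵥ x 0) := by
      rw [Matrix.mulVec_add, Matrix.mulVec_smul, Matrix.mulVec_mulVec]
      have : Q * (Matrix.of Z)ᵀ = 0 := by
        ext i j
        exact congrFun (hQZ j) i
      rw [this, Matrix.zero_mulVec, add_zero]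
    have h3 := kb_contr Q hQ (a • x 0 + (Matrix.of Z)ᵀ *ᵥ w)
    rw [e2, smul_dotProduct, dotProduct_smul, smul_eq_mul, smul_eq_mul] at h3
    simp only [] at hw
    set y := (Q *ᵥ x 0) ⬝ᵥ (Q *ᵥ x 0)
    have h4 : s ^ 2 * (a * (a * y)) < (c * a) ^ 2 := lt_of_le_of_lt (by gcongr) hw
    rw [div_pow, lt_div_iff₀ (by positivity)]
    by_contra hcon
    push Not at hcon
    nlinarith [sq_nonneg a]
  calc _ ≤ ∫⁻ _, ENNReal.ofReal ((c / s) ^ r / ((√2) ^ r * Real.Gamma (r / 2 + 1)))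
        ∂(kbM (Fin q') (Fin N)) := lintegral_mono hb
    _ = _ := by simp

end SmallX

section Steps
open MeasureTheory ProbabilityTheory

lemma kb_dp_nonneg {ι : Type*} [Fintype ι] (v : ι → ℝ) : 0 ≤ v ⬝ᵥ v := by
  rw [← kb_sum_sq]; positivity

lemma kb_cs {ι : Type*} [Fintype ι] (u v : ι → ℝ) : (u ⬝ᵥ v) ^ 2 ≤ (u ⬝ᵥ u) * (v ⬝ᵥ v) := by
  rw [← kb_sum_sq, ← kb_sum_sq]
  exact Finset.sum_mul_sq_le_sq_mul_sq _ _ _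

lemma kb_gram_dot {q N : ℕ} (X : Matrix (Fin q) (Fin N) ℝ) (v w : Fin q → ℝ) :
    (Xᵀ *ᵥ v) ⬝ᵥ (Xᵀ *ᵥ w) = v ⬝ᵥ ((X * Xᵀ) *ᵥ w) := by
  rw [dotProduct_comm, Matrix.dotProduct_mulVec, Matrix.vecMul_transpose, Matrix.mulVec_mulVec,
    dotProduct_comm]

def kbF {q N : ℕ} (s : ℝ) : Set ((Fin q → Fin N → ℝ) × (Fin N → ℝ)) :=
  {P | ∃ w : Fin q → ℝ,
    s ^ 2 * (((Matrix.of P.1 * (Matrix.of P.1)ᵀ) *ᵥ w) ⬝ᵥ ((Matrix.of P.1 * (Matrix.of P.1)ᵀ) *ᵥ w))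
      < (w ⬝ᵥ (Matrix.of P.1 *ᵥ P.2)) ^ 2}

lemma kbF_open {q N : ℕ} (s : ℝ) : IsOpen (kbF (q := q) (N := N) s) := by
  have : kbF (q := q) (N := N) s = ⋃ w : Fin q → ℝ, {P | 
    s ^ 2 * (((Matrix.of P.1 * (Matrix.of P.1)ᵀ) *ᵥ w) ⬝ᵥ ((Matrix.of P.1 * (Matrix.of P.1)ᵀ) *ᵥ w))
      < (w ⬝ᵥ (Matrix.of P.1 *ᵥ P.2)) ^ 2} := by
    ext P; simp [kbF]
  rw [this]
  refine isOpen_iUnion fun w => isOpen_lt ?_ ?_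
  · simp only [Matrix.mulVec, dotProduct, Matrix.mul_apply, Matrix.transpose_apply, Matrix.of_apply]
    fun_prop
  · simp only [Matrix.mulVec, dotProduct, Matrix.of_apply]
    fun_prop

lemma kbE_smul {q N : ℕ} {s c : ℝ} (hc : 0 < c) (g : Fin q → ℝ) (X : Fin q → Fin N → ℝ) :
    (g, X) ∈ kbE (s / c) ↔ (c • g, X) ∈ kbE s := by
  refine exists_congr fun w => ?_
  simp only [smul_dotProduct, smul_eq_mul]
  rw [div_pow, div_mul_eq_mul_div, div_lt_iff₀ (by positivity), mul_pow, mul_comm (c ^ 2)]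

lemma kbF_smul {q N : ℕ} {s c : ℝ} (hc : 0 < c) (y : Fin N → ℝ) (X : Fin q → Fin N → ℝ) :
    (X, y) ∈ kbF (s / c) ↔ (X, c • y) ∈ kbF s := by
  refine exists_congr fun w => ?_
  simp only [Matrix.mulVec_smul, dotProduct_smul, smul_eq_mul]
  rw [div_pow, div_mul_eq_mul_div, div_lt_iff₀ (by positivity), mul_pow, mul_comm (c ^ 2)]

/-- step 2 for a unit vector -/
lemma kb_step2 {q N : ℕ} (s : ℝ) (X : Fin q → Fin N → ℝ)
    (hX : (Matrix.of X * (Matrix.of X)ᵀ).det ≠ 0) :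
    kbG (Fin N) {h | (X, h) ∈ kbF s} ≤ kbG (Fin q) {g | (g, X) ∈ kbE s} := by
  have hps : (Matrix.of X * (Matrix.of X)ᵀ).PosSemidef := by
    have := Matrix.posSemidef_self_mul_conjTranspose (Matrix.of X)
    simpa using this
  obtain ⟨U, hU, hU', hA, -, hd⟩ := kb_eig hps
  set G := Matrix.of X * (Matrix.of X)ᵀ with hG
  set R := U * diagonal (fun i => √(eigDesc G i)) * Uᵀ with hR
  have hRR : R * R = G := by
    rw [hA]
    exact kb_sq hU hd
  have hRt : Rᵀ = R := kb_symm U _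
  clear_value R
  have hRd : R.det ≠ 0 := by
    intro h
    apply hX
    rw [← hRR, Matrix.det_mul, h, zero_mul]
  have hRu : IsUnit R.det := isUnit_iff_ne_zero.2 hRd
  have hV : (R⁻¹ * Matrix.of X) * (R⁻¹ * Matrix.of X)ᵀ = 1 := by
    rw [Matrix.transpose_mul, Matrix.transpose_nonsing_inv, hRt, Matrix.mul_assoc,
      ← Matrix.mul_assoc (Matrix.of X), ← hG, ← hRR, Matrix.mul_assoc R,
      Matrix.mul_nonsing_inv _ hRu, Matrix.mul_one, Matrix.nonsing_inv_mul _ hRu]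
  have hm : MeasurableSet {g : Fin q → ℝ | (g, X) ∈ kbE s} :=
    ((kbE_open s).preimage (by fun_prop : Continuous fun g : Fin q → ℝ => (g, X))).measurableSet
  rw [← (kb_mulVec_law hV).measure_preimage hm.nullMeasurableSet]
  refine measure_mono ?_
  rintro h ⟨w, hw⟩
  refine ⟨R *ᵥ w, ?_⟩
  simp only [] at hw ⊢
  rw [← hG] at hw
  have e1 : (R⁻¹ * Matrix.of X) *ᵥ h ⬝ᵥ R *ᵥ w = w ⬝ᵥ Matrix.of X *ᵥ h := by
    rw [Matrix.dotProduct_mulVec, ← Matrix.mulVec_transpose, hRt, Matrix.mulVec_mulVec,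
      ← Matrix.mul_assoc, Matrix.mul_nonsing_inv _ hRu, Matrix.one_mul, dotProduct_comm]
  have e2 : ((Matrix.of X)ᵀ *ᵥ (R *ᵥ w)) ⬝ᵥ ((Matrix.of X)ᵀ *ᵥ (R *ᵥ w)) =
      (G *ᵥ w) ⬝ᵥ (G *ᵥ w) := by
    rw [kb_gram_dot, ← hG]
    have : ∀ a b : Fin q → ℝ, (R *ᵥ a) ⬝ᵥ b = a ⬝ᵥ (R *ᵥ b) := by
      intro a b
      rw [Matrix.dotProduct_mulVec, ← Matrix.mulVec_transpose, hRt]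
    rw [← hRR]
    simp only [← Matrix.mulVec_mulVec, this]
  rw [e1, e2]
  exact hw

lemma kb_step2' {q m N : ℕ} (s : ℝ) (X : Fin q → Fin N → ℝ)
    (hX : (Matrix.of X * (Matrix.of X)ᵀ).det ≠ 0) (g : Fin m → ℝ) :
    kbM (Fin m) (Fin N) {Y | (X, (Matrix.of Y)ᵀ *ᵥ g) ∈ kbF s} ≤
      kbG (Fin q) {g' | (√(g ⬝ᵥ g) • g', X) ∈ kbE s} := by
  by_cases hg : g = 0
  · have : {Y : Fin m → Fin N → ℝ | (X, (Matrix.of Y)ᵀ *ᵥ g) ∈ kbF s} = ∅ := by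
      ext Y
      simp only [kbF, Set.mem_ofPred_eq, Set.mem_empty_iff_false, iff_false, not_exists, not_lt, hg,
        Matrix.mulVec_zero, dotProduct_zero]
      intro w
      have h2 := mul_nonneg (sq_nonneg s) (kb_dp_nonneg ((Matrix.of X * (Matrix.of X)ᵀ) *ᵥ w))
      simpa using h2
    rw [this]; simp
  have hgg : 0 < g ⬝ᵥ g := by
    rcases (kb_dp_nonneg g).lt_or_eq with h | h
    · exact h
    · exact absurd (dotProduct_self_eq_zero.1 h.symm) hg
  set c := √(g ⬝ᵥ g) with hc
  have hc0 : 0 < c := Real.sqrt_pos.2 hgg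
  have hcc : c * c = g ⬝ᵥ g := Real.mul_self_sqrt hgg.le
  have hu : (c⁻¹ • g) ⬝ᵥ (c⁻¹ • g) = 1 := by
    rw [smul_dotProduct, dotProduct_smul, ← hcc]; simp; field_simp
  have hgc : g = c • (c⁻¹ • g) := by rw [smul_smul, mul_inv_cancel₀ hc0.ne', one_smul]
  have l := kb_vecMul_law (κ := Fin m) (ι := Fin N) hu
  have hm : MeasurableSet {h : Fin N → ℝ | (X, h) ∈ kbF (s / c)} :=
    ((kbF_open _).preimage (by fun_prop : Continuous fun h : Fin N → ℝ => (X, h))).measurableSet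
  have e1 : {Y : Fin m → Fin N → ℝ | (X, (Matrix.of Y)ᵀ *ᵥ g) ∈ kbF s} =
      (fun Y => (Matrix.of Y)ᵀ *ᵥ (c⁻¹ • g)) ⁻¹' {h : Fin N → ℝ | (X, h) ∈ kbF (s / c)} := by
    ext Y
    simp only [Set.mem_ofPred_eq, Set.mem_preimage]
    rw [kbF_smul hc0, ← Matrix.mulVec_smul, ← hgc]
  rw [e1, l.measure_preimage hm.nullMeasurableSet]
  refine (kb_step2 _ X hX).trans (le_of_eq ?_)
  congr 1
  ext g'
  exact kbE_smul hc0 g' X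

lemma kb_step1 {q m N : ℕ} {a T : ℝ} (ha : 0 < a) (hT : 0 < T) (X : Fin q → Fin N → ℝ)
    (Y : Fin m → Fin N → ℝ)
    (hX : (Matrix.of X * (Matrix.of X)ᵀ).det ≠ 0) (z1 : Fin q → ℝ) (z2 : Fin m → ℝ)
    (hz : (Matrix.of X)ᵀ *ᵥ z1 + (Matrix.of Y)ᵀ *ᵥ z2 = 0)
    (hlt : T ^ 2 * (z2 ⬝ᵥ z2) < z1 ⬝ᵥ z1) :
    gaussianReal 0 1 {z | a < |z|} ≤
      kbG (Fin m) {g | (X, (Matrix.of Y)ᵀ *ᵥ g) ∈ kbF (a * T)} := by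
  set G := Matrix.of X * (Matrix.of X)ᵀ with hG
  have hGu : IsUnit G.det := isUnit_iff_ne_zero.2 hX
  set w := G⁻¹ *ᵥ z1 with hw
  have hGw : G *ᵥ w = z1 := by
    rw [hw, Matrix.mulVec_mulVec, Matrix.mul_nonsing_inv _ hGu, Matrix.one_mulVec]
  set v := Matrix.of Y *ᵥ ((Matrix.of X)ᵀ *ᵥ w) with hv
  have hvg : ∀ g : Fin m → ℝ, w ⬝ᵥ (Matrix.of X *ᵥ ((Matrix.of Y)ᵀ *ᵥ g)) = g ⬝ᵥ v := by
    intro g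
    rw [hv, Matrix.dotProduct_mulVec, ← Matrix.mulVec_transpose, Matrix.dotProduct_mulVec,
      ← Matrix.mulVec_transpose, Matrix.transpose_transpose, dotProduct_comm]
  have h1 : z2 ⬝ᵥ v = - (z1 ⬝ᵥ z1) := by
    rw [← hvg, eq_neg_of_add_eq_zero_right hz, Matrix.mulVec_neg, dotProduct_neg,
      Matrix.mulVec_mulVec, ← hG, Matrix.dotProduct_mulVec, ← Matrix.mulVec_transpose]
    have : Gᵀ = G := by rw [hG, Matrix.transpose_mul, Matrix.transpose_transpose]
    rw [this, hGw]
  have hz1 : 0 < z1 ⬝ᵥ z1 := lt_of_le_of_lt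
    (mul_nonneg (sq_nonneg T) (kb_dp_nonneg z2)) hlt
  have h2 := kb_cs z2 v
  rw [h1] at h2
  have hvv : T ^ 2 * (z1 ⬝ᵥ z1) ≤ v ⬝ᵥ v := by
    have h3 : (z1 ⬝ᵥ z1) * (T ^ 2 * (z1 ⬝ᵥ z1)) ≤ (z1 ⬝ᵥ z1) * (v ⬝ᵥ v) := by
      calc _ = T ^ 2 * (-(z1 ⬝ᵥ z1)) ^ 2 := by ring
        _ ≤ T ^ 2 * ((z2 ⬝ᵥ z2) * (v ⬝ᵥ v)) := by gcongr
        _ = (T ^ 2 * (z2 ⬝ᵥ z2)) * (v ⬝ᵥ v) := by ring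
        _ ≤ _ := by gcongr; exact kb_dp_nonneg v
    exact le_of_mul_le_mul_left h3 hz1
  have hgg : 0 < v ⬝ᵥ v := lt_of_lt_of_le (by positivity) hvv
  set c := √(v ⬝ᵥ v) with hc
  have hc0 : 0 < c := Real.sqrt_pos.2 hgg
  have hcc : c * c = v ⬝ᵥ v := Real.mul_self_sqrt hgg.le
  have hu : (c⁻¹ • v) ⬝ᵥ (c⁻¹ • v) = 1 := by
    rw [smul_dotProduct, dotProduct_smul, ← hcc]; simp; field_simp
  have hm : MeasurableSet {z : ℝ | a < |z|} :=
    (isOpen_lt continuous_const continuous_abs).measurableSet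
  rw [← (kb_dot_law hu).measure_preimage hm.nullMeasurableSet]
  refine measure_mono ?_
  intro g hg
  simp only [Set.mem_preimage, Set.mem_ofPred_eq] at hg
  refine ⟨w, ?_⟩
  simp only []
  rw [← hG, hGw, hvg]
  rw [dotProduct_smul, smul_eq_mul] at hg
  have h5 : a ^ 2 < (c⁻¹ * (g ⬝ᵥ v)) ^ 2 := by
    rw [← sq_abs (c⁻¹ * _)]
    gcongr
  rw [mul_pow, inv_pow, inv_mul_eq_div, lt_div_iff₀ (by positivity)] at h5
  calc (a * T) ^ 2 * (z1 ⬝ᵥ z1) = a ^ 2 * (T ^ 2 * (z1 ⬝ᵥ z1)) := by ring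
    _ ≤ a ^ 2 * c ^ 2 := by gcongr; rw [sq c, hcc]; exact hvv
    _ < _ := h5

lemma kb_det_null {q N r : ℕ} (hr : 0 < r) (h : q + r = N + 1) :
    kbM (Fin q) (Fin N) {X | (Matrix.of X * (Matrix.of X)ᵀ).det = 0} = 0 := by
  classical
  have hsub : {X : Fin q → Fin N → ℝ | (Matrix.of X * (Matrix.of X)ᵀ).det = 0} ⊆
      ⋃ i : Fin q, {X | ∀ s : ℝ, (Pi.single i 1, X) ∈ kbE s} := by
    intro X hX
    simp only [Set.mem_ofPred_eq] at hX
    obtain ⟨w, hw0, hw⟩ := Matrix.exists_mulVec_eq_zero_iff.2 hX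
    obtain ⟨i, hi⟩ := Function.ne_iff.1 hw0
    have h0 : ((Matrix.of X)ᵀ *ᵥ w) ⬝ᵥ ((Matrix.of X)ᵀ *ᵥ w) = 0 := by
      rw [kb_gram_dot, hw, dotProduct_zero]
    refine Set.mem_iUnion.2 ⟨i, fun s => ⟨w, ?_⟩⟩
    simp only [h0, mul_zero, single_dotProduct, one_mul]
    have : w i ≠ 0 := hi
    positivity
  refine measure_mono_null hsub (measure_iUnion_null fun i => ?_)
  have hlim : Filter.Tendsto (fun s : ℝ => ENNReal.ofReal
      ((√((Pi.single i 1 : Fin q → ℝ) ⬝ᵥ (Pi.single i 1)) / s) ^ r /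
        ((√2) ^ r * Real.Gamma (r / 2 + 1)))) Filter.atTop (nhds 0) := by
    rw [← ENNReal.ofReal_zero]
    refine ENNReal.tendsto_ofReal ?_
    have h1 : Filter.Tendsto (fun s : ℝ => √((Pi.single i 1 : Fin q → ℝ) ⬝ᵥ (Pi.single i 1)) / s)
      Filter.atTop (nhds 0) := Filter.Tendsto.const_div_atTop Filter.tendsto_id _
    have h2 := (h1.pow r).div_const ((√2) ^ r * Real.Gamma (r / 2 + 1))
    rwa [zero_pow hr.ne', zero_div] at h2
  refine le_antisymm (ge_of_tendsto hlim ?_) (by simp)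
  filter_upwards [Filter.eventually_gt_atTop 0] with s hs
  have hss : {X : Fin q → Fin N → ℝ | ∀ s : ℝ, (Pi.single i 1, X) ∈ kbE s} ⊆
      {X | (Pi.single i 1, X) ∈ kbE s} := fun X hX => Set.mem_ofPred_eq ▸ (hX s)
  exact (measure_mono hss).trans (kb_smallX hr h _ hs)

end Steps

section Combine
open MeasureTheory ProbabilityTheory

noncomputable def kbf {q m N : ℕ} (s : ℝ) (P : (Fin q → Fin N → ℝ) × (Fin m → Fin N → ℝ)) :
    ENNReal :=
  kbG (Fin m) {g | (P.1, (Matrix.of P.2)ᵀ *ᵥ g) ∈ kbF s}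

lemma kbH_meas {q m N : ℕ} (s : ℝ) : MeasurableSet
    {Z : ((Fin q → Fin N → ℝ) × (Fin m → Fin N → ℝ)) × (Fin m → ℝ) |
      (Z.1.1, (Matrix.of Z.1.2)ᵀ *ᵥ Z.2) ∈ kbF s} := by
  refine ((kbF_open s).preimage (f := fun Z : ((Fin q → Fin N → ℝ) × (Fin m → Fin N → ℝ)) ×
    (Fin m → ℝ) => (Z.1.1, (Matrix.of Z.1.2)ᵀ *ᵥ Z.2)) ?_).measurableSet
  refine Continuous.prodMk (by fun_prop) ?_
  refine continuous_pi fun j => ?_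
  simp only [Matrix.mulVec, dotProduct, Matrix.transpose_apply, Matrix.of_apply]
  fun_prop

lemma kbf_meas {q m N : ℕ} (s : ℝ) : Measurable (kbf (q := q) (m := m) (N := N) s) :=
  measurable_measure_prodMk_left (kbH_meas s)

lemma kb_combine {q m N r : ℕ} (hr : 3 ≤ r) (hq : 1 ≤ q) (hm : 1 ≤ m) (h : q + r = N + 1) {s : ℝ}
    (hs : 0 < s) :
    ∫⁻ P, kbf s P ∂((kbM (Fin q) (Fin N)).prod (kbM (Fin m) (Fin N))) ≤
      ENNReal.ofReal ((√((m:ℝ) + r - 1) * √(N:ℝ) / s) ^ r / ((√2) ^ r * Real.Gamma (r / 2 + 1))) := by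
  have hr0 : 0 < r := by omega
  set K := (√2) ^ r * Real.Gamma (r / 2 + 1) with hK
  have hKp : 0 < K := by
    have : 0 < Real.Gamma ((r:ℝ) / 2 + 1) := Real.Gamma_pos_of_pos (by positivity)
    positivity
  have hc : ∀ v : Fin m → ℝ, 0 ≤ √(v ⬝ᵥ v) := fun v => Real.sqrt_nonneg _
  have e1 : ∫⁻ P, kbf s P ∂((kbM (Fin q) (Fin N)).prod (kbM (Fin m) (Fin N))) =
      ∫⁻ g : Fin m → ℝ, ((kbM (Fin q) (Fin N)).prod (kbM (Fin m) (Fin N)))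
        {P | (P.1, (Matrix.of P.2)ᵀ *ᵥ g) ∈ kbF s} ∂(kbG (Fin m)) := by
    have h1 := Measure.prod_apply (μ := (kbM (Fin q) (Fin N)).prod (kbM (Fin m) (Fin N)))
      (ν := kbG (Fin m)) (kbH_meas s)
    have h2 := Measure.prod_apply_symm (μ := (kbM (Fin q) (Fin N)).prod (kbM (Fin m) (Fin N)))
      (ν := kbG (Fin m)) (kbH_meas s)
    exact h1.symm.trans h2
  rw [e1]
  have hsec : ∀ g : Fin m → ℝ, ((kbM (Fin q) (Fin N)).prod (kbM (Fin m) (Fin N)))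
        {P | (P.1, (Matrix.of P.2)ᵀ *ᵥ g) ∈ kbF s} ≤
      ENNReal.ofReal (√(g ⬝ᵥ g) ^ r) * ENNReal.ofReal (√(N:ℝ) ^ r / s ^ r / K) := by
    intro g
    have hms : MeasurableSet {P : (Fin q → Fin N → ℝ) × (Fin m → Fin N → ℝ) |
        (P.1, (Matrix.of P.2)ᵀ *ᵥ g) ∈ kbF s} :=
      measurable_prodMk_right (y := g) (kbH_meas s)
    have hmE : MeasurableSet {Z : (Fin q → Fin N → ℝ) × (Fin q → ℝ) |
        (√(g ⬝ᵥ g) • Z.2, Z.1) ∈ kbE s} :=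
      ((kbE_open s).preimage (f := fun Z : (Fin q → Fin N → ℝ) × (Fin q → ℝ) =>
        (√(g ⬝ᵥ g) • Z.2, Z.1)) (by fun_prop)).measurableSet
    rw [Measure.prod_apply hms]
    calc _ ≤ ∫⁻ X, kbG (Fin q) {g' | (√(g ⬝ᵥ g) • g', X) ∈ kbE s} ∂(kbM (Fin q) (Fin N)) := by
          refine lintegral_mono_ae ?_
          have hn := kb_det_null (q := q) (N := N) hr0 h
          have : ∀ᵐ X ∂(kbM (Fin q) (Fin N)), (Matrix.of X * (Matrix.of X)ᵀ).det ≠ 0 := by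
            rw [ae_iff]
            simpa using hn
          filter_upwards [this] with X hX
          exact kb_step2' s X hX g
      _ = ∫⁻ g', kbM (Fin q) (Fin N) {X | (√(g ⬝ᵥ g) • g', X) ∈ kbE s} ∂(kbG (Fin q)) := by
          have h1 := Measure.prod_apply (μ := kbM (Fin q) (Fin N)) (ν := kbG (Fin q)) hmE
          have h2 := Measure.prod_apply_symm (μ := kbM (Fin q) (Fin N)) (ν := kbG (Fin q)) hmE
          exact h1.symm.trans h2
      _ ≤ ∫⁻ g', ENNReal.ofReal (√(g ⬝ᵥ g) ^ r / s ^ r / K) * ENNReal.ofReal (√(g' ⬝ᵥ g') ^ r)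
            ∂(kbG (Fin q)) := by
          refine lintegral_mono fun g' => ?_
          refine (kb_smallX hr0 h _ hs).trans (le_of_eq ?_)
          rw [← ENNReal.ofReal_mul (by positivity)]
          congr 1
          rw [smul_dotProduct, dotProduct_smul, smul_eq_mul, smul_eq_mul, ← mul_assoc,
            Real.sqrt_mul (by positivity), Real.sqrt_mul_self (hc g), div_pow, mul_pow]
          ring
      _ = ENNReal.ofReal (√(g ⬝ᵥ g) ^ r / s ^ r / K) *
            ∫⁻ g', ENNReal.ofReal (√(g' ⬝ᵥ g') ^ r) ∂(kbG (Fin q)) := by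
          refine lintegral_const_mul' _ _ ENNReal.ofReal_ne_top
      _ ≤ ENNReal.ofReal (√(g ⬝ᵥ g) ^ r / s ^ r / K) * ENNReal.ofReal (√((q:ℝ) + r - 1) ^ r) := by
          gcongr
          exact kb_moment q r hq hr
      _ = _ := by
          have : (q:ℝ) + r - 1 = N := by
            have : ((q + r : ℕ) : ℝ) = ((N + 1 : ℕ) : ℝ) := by rw [h]
            push_cast at this
            linarith
          rw [this, ← ENNReal.ofReal_mul (by positivity), ← ENNReal.ofReal_mul (by positivity)]
          congr 1
          ring
  calc _ ≤ ∫⁻ g : Fin m → ℝ, ENNReal.ofReal (√(g ⬝ᵥ g) ^ r) * ENNReal.ofReal (√(N:ℝ) ^ r / s ^ r / K)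
        ∂(kbG (Fin m)) := lintegral_mono hsec
    _ = (∫⁻ g : Fin m → ℝ, ENNReal.ofReal (√(g ⬝ᵥ g) ^ r) ∂(kbG (Fin m))) *
        ENNReal.ofReal (√(N:ℝ) ^ r / s ^ r / K) := lintegral_mul_const' _ _ ENNReal.ofReal_ne_top
    _ ≤ ENNReal.ofReal (√((m:ℝ) + r - 1) ^ r) * ENNReal.ofReal (√(N:ℝ) ^ r / s ^ r / K) := by
        gcongr
        exact kb_moment m r hm hr
    _ = _ := by
        rw [← ENNReal.ofReal_mul (by positivity), div_pow, mul_pow]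
        congr 1
        ring

/-- Final probability bound. -/
lemma kb_prob {q m N r : ℕ} (hr : 3 ≤ r) (hq : 1 ≤ q) (hm : 1 ≤ m) (h : q + r = N + 1)
    {δ L T : ℝ} (hδ : 0 < δ) (hL : √((m:ℝ) + r - 1) ≤ L) (hT : 0 < T)
    (hTr : T ^ r = L ^ r * (2 / δ) * (Real.exp 1 * √(N:ℝ) / r) ^ r) :
    ∃ S : Set ((Fin q → Fin N → ℝ) × (Fin m → Fin N → ℝ)), MeasurableSet S ∧
      ((kbM (Fin q) (Fin N)).prod (kbM (Fin m) (Fin N))) S ≤ ENNReal.ofReal δ ∧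
      ∀ P ∉ S, ∀ z1 z2, (Matrix.of P.1)ᵀ *ᵥ z1 + (Matrix.of P.2)ᵀ *ᵥ z2 = 0 →
        z1 ⬝ᵥ z1 ≤ T ^ 2 * (z2 ⬝ᵥ z2) := by
  have hrp : (0:ℝ) < r := by exact_mod_cast (by omega : 0 < r)
  set a := √(r:ℝ) with ha
  have ha0 : 0 < a := Real.sqrt_pos.2 hrp
  set M := √(2 / Real.pi) * (a / (1 + a ^ 2)) * Real.exp (-a ^ 2 / 2) with hM
  have hMp : 0 < M := by positivity
  have hmills := kb_mills ha0
  rw [← hM] at hmills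
  let S1 : Set ((Fin q → Fin N → ℝ) × (Fin m → Fin N → ℝ)) :=
    {P | ENNReal.ofReal M ≤ kbf (a * T) P}
  let S2 : Set ((Fin q → Fin N → ℝ) × (Fin m → Fin N → ℝ)) :=
    {X | (Matrix.of X * (Matrix.of X)ᵀ).det = 0} ×ˢ Set.univ
  have hS2 : ((kbM (Fin q) (Fin N)).prod (kbM (Fin m) (Fin N))) S2 = 0 := by
    rw [Measure.prod_prod, kb_det_null (by omega) h, zero_mul]
  have hmS2 : MeasurableSet S2 := by
    refine MeasurableSet.prod ?_ MeasurableSet.univ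
    refine (isClosed_eq ?_ continuous_const).measurableSet
    refine Continuous.matrix_det ?_
    refine continuous_matrix fun i j => ?_
    simp only [Matrix.mul_apply, Matrix.transpose_apply, Matrix.of_apply]
    fun_prop
  refine ⟨S1 ∪ S2, (measurableSet_le measurable_const (kbf_meas _)).union hmS2, ?_, ?_⟩
  · refine (measure_union_le _ _).trans ?_
    rw [hS2, add_zero]
    have h1 := (mul_meas_ge_le_lintegral (μ := (kbM (Fin q) (Fin N)).prod (kbM (Fin m) (Fin N)))
      (kbf_meas (a * T)) (ENNReal.ofReal M)).trans (kb_combine hr hq hm h (by positivity))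
    have h2 : (√((m:ℝ) + r - 1) * √(N:ℝ) / (a * T)) ^ r / ((√2) ^ r * Real.Gamma (r / 2 + 1)) ≤
        M * δ := by
      have hk := kb_const hr
      rw [← ha, ← hM] at hk
      set K := (√2) ^ r * Real.Gamma (r / 2 + 1) with hK
      have hKp : 0 < K := by
        have : 0 < Real.Gamma ((r:ℝ) / 2 + 1) := Real.Gamma_pos_of_pos (by positivity)
        positivity
      have hLr : √((m:ℝ) + r - 1) ^ r ≤ L ^ r := by gcongr
      have hNp : 0 < T ^ r := by positivity
      have hL0 : 0 ≤ L := (Real.sqrt_nonneg _).trans hL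
      rw [div_pow, mul_pow, mul_pow, div_div, div_le_iff₀ (by positivity), hTr]
      rw [div_le_iff₀ hKp] at hk
      calc √((m:ℝ) + r - 1) ^ r * √(N:ℝ) ^ r ≤ L ^ r * √(N:ℝ) ^ r := by gcongr
        _ = L ^ r * (Real.exp 1 * √(N:ℝ) / r) ^ r * (r / Real.exp 1) ^ r := by
            have : √(N:ℝ) = (Real.exp 1 * √(N:ℝ) / r) * (r / Real.exp 1) := by field_simp
            rw [mul_assoc, ← mul_pow (Real.exp 1 * √(N:ℝ) / r), ← this]
        _ ≤ L ^ r * (Real.exp 1 * √(N:ℝ) / r) ^ r * (2 * a ^ r * M * K) := by gcongr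
        _ = _ := by field_simp
    have h3 : ENNReal.ofReal M * ((kbM (Fin q) (Fin N)).prod (kbM (Fin m) (Fin N))) S1 ≤
        ENNReal.ofReal M * ENNReal.ofReal δ := by
      rw [← ENNReal.ofReal_mul hMp.le]
      exact h1.trans (ENNReal.ofReal_le_ofReal h2)
    refine (ENNReal.mul_le_mul_iff_right ?_ ENNReal.ofReal_ne_top).1 h3
    exact (ENNReal.ofReal_pos.2 hMp).ne'
  · intro P hP z1 z2 hz
    by_contra hcon
    push Not at hcon
    have hd : (Matrix.of P.1 * (Matrix.of P.1)ᵀ).det ≠ 0 := fun h0 => hP (Or.inr ⟨h0, trivial⟩)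
    exact hP (Or.inl (hmills.trans (kb_step1 ha0 hT P.1 P.2 hd z1 z2 hz hcon)))

end Combine

open MeasureTheory in
/-- probabilistic error bound for the block-Krylov trace-of-log
approximation with a standard Gaussian starting block (cf. Li et al.).
Here `eigDesc A ⟨i-1, _⟩` is the `i`-th largest eigenvalue `λ_i` of `A` (1-based). -/
theorem stmt8 {n nΩ q p k : ℕ} (hq : 2 ≤ q) (hp : 2 ≤ p) (hnΩ : nΩ = q + p)
    (hqn : q < n) (hk : 2 ≤ k)
    (A : Matrix (Fin n) (Fin n) ℝ) (hA : A.PosSemidef)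
    (hlq : 0 < eigDesc A ⟨q - 1, by omega⟩)
    (lam : ℝ) (hlam : 0 < lam)
    (δ : ℝ) (hδ : δ ∈ Set.Ioo (0 : ℝ) 1) :
    -- the measure of standard Gaussian random matrices `Ω ∈ ℝ^{n×nΩ}`
    ENNReal.ofReal (1 - δ) ≤
      (Measure.pi fun _ : Fin n => Measure.pi fun _ : Fin nΩ =>
          ProbabilityTheory.gaussianReal 0 1)
        {Ω : Fin n → Fin nΩ → ℝ |
          ∀ (r : ℕ) (W : Matrix (Fin n) (Fin r) ℝ), Wᵀ * W = 1 →
            colSpan W = krylov k A (Matrix.of Ω) →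
            0 ≤ traceLog (lam • 1 + A) -
                  traceLog (lam • 1 + W * (Wᵀ * A * W) * Wᵀ) ∧
            traceLog (lam • 1 + A) - traceLog (lam • 1 + W * (Wᵀ * A * W) * Wᵀ) ≤
              traceLog
                ((1 : Matrix (Fin (n - q)) (Fin (n - q)) ℝ) +
                  (((Real.sqrt ((n : ℝ) - q) + Real.sqrt (nΩ : ℝ) +
                        Real.sqrt (2 * Real.log (2 / δ))) ^ 2 *
                      (2 / δ) ^ ((2 : ℝ) / ((p : ℝ) + 1)) *
                      (Real.exp 1 * Real.sqrt (nΩ : ℝ) / ((p : ℝ) + 1)) ^ 2) *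
                    (eigDesc A ⟨q, hqn⟩ / eigDesc A ⟨q - 1, by omega⟩) *
                    (((Polynomial.Chebyshev.T ℝ ((k : ℤ) - 2)).eval
                        ((2 * eigDesc A ⟨q - 1, by omega⟩ - eigDesc A ⟨q, hqn⟩) /
                          eigDesc A ⟨q, hqn⟩))⁻¹) ^ 2 *
                    lam⁻¹) •
                    Matrix.diagonal
                      (fun i : Fin (n - q) =>
                        eigDesc A ⟨q + i.1, by have := i.isLt; omega⟩)) +
              traceLog
                ((1 : Matrix (Fin (n - q)) (Fin (n - q)) ℝ) +
                  lam⁻¹ •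
                    Matrix.diagonal
                      (fun i : Fin (n - q) =>
                        eigDesc A ⟨q + i.1, by have := i.isLt; omega⟩))} := by
  classical
  set d := eigDesc A with hd
  obtain ⟨U, hU, hU', hAU, hanti, hdn⟩ := kb_eig hA
  obtain ⟨hδ0, hδ1⟩ := hδ
  set L := Real.sqrt ((n : ℝ) - q) + Real.sqrt (nΩ : ℝ) + Real.sqrt (2 * Real.log (2 / δ)) with hL
  have hp1 : (0:ℝ) < (p:ℝ) + 1 := by positivity
  have hmq : ((n - q : ℕ) : ℝ) = (n:ℝ) - q := by rw [Nat.cast_sub hqn.le]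
  have hNpos : (0:ℝ) < nΩ := by rw [hnΩ]; exact_mod_cast (by omega : 0 < q + p)
  have hsN : 0 < √(nΩ:ℝ) := Real.sqrt_pos.2 hNpos
  have hL0 : 0 < L := by positivity
  have h2δ : 0 < 2 / δ := by positivity
  set T := L * (2 / δ) ^ ((1:ℝ) / ((p:ℝ) + 1)) * (Real.exp 1 * √(nΩ:ℝ) / ((p:ℝ) + 1)) with hT
  have hT0 : 0 < T := by positivity
  have hT2 : T ^ 2 = L ^ 2 * (2 / δ) ^ ((2 : ℝ) / ((p : ℝ) + 1)) *
      (Real.exp 1 * Real.sqrt (nΩ : ℝ) / ((p : ℝ) + 1)) ^ 2 := by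
    rw [hT, mul_pow, mul_pow]
    congr 2
    rw [← Real.rpow_natCast, ← Real.rpow_mul h2δ.le]
    congr 1
    push_cast; ring
  have hTr : T ^ (p + 1) = L ^ (p + 1) * (2 / δ) *
      (Real.exp 1 * √(nΩ:ℝ) / ((p + 1 : ℕ) : ℝ)) ^ (p + 1) := by
    rw [hT, mul_pow, mul_pow]
    push_cast
    congr 2
    rw [← Real.rpow_natCast, ← Real.rpow_mul h2δ.le]
    push_cast
    rw [one_div, inv_mul_cancel₀ hp1.ne', Real.rpow_one]
  have hLm : √(((n - q : ℕ) : ℝ) + ((p + 1 : ℕ) : ℝ) - 1) ≤ L := by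
    have hx : (0:ℝ) ≤ (n:ℝ) - q := by rw [← hmq]; positivity
    have h1 : ((n - q : ℕ) : ℝ) + ((p + 1 : ℕ) : ℝ) - 1 = ((n:ℝ) - q) + p := by
      rw [hmq]; push_cast; ring
    rw [h1]
    have h2 : √(p:ℝ) ≤ √(nΩ:ℝ) := Real.sqrt_le_sqrt (by rw [hnΩ]; push_cast; linarith [(Nat.cast_nonneg q : (0:ℝ) ≤ q)])
    have h3 : √(((n:ℝ) - q) + p) ≤ √((n:ℝ) - q) + √(p:ℝ) := by
      rw [Real.sqrt_le_left (by positivity)]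
      have e1 := Real.sq_sqrt hx
      have e2 := Real.sq_sqrt (Nat.cast_nonneg p : (0:ℝ) ≤ p)
      have e3 : 0 ≤ √((n:ℝ) - q) * √(p:ℝ) := by positivity
      nlinarith
    have h4 : 0 ≤ √(2 * Real.log (2 / δ)) := Real.sqrt_nonneg _
    rw [hL]; linarith
  obtain ⟨S, hSm, hSδ, hS⟩ := kb_prob (q := q) (m := n - q) (N := nΩ) (r := p + 1) (by omega)
    (by omega) (by omega) (by omega) hδ0 hLm hT0 hTr
  let σ : Fin q ⊕ Fin (n - q) ≃ Fin n := finSumFinEquiv.trans (finCongr (by omega))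
  have hσl : ∀ i, (σ (Sum.inl i)).1 = i.1 := fun i => by simp [σ]
  have hσr : ∀ i, (σ (Sum.inr i)).1 = q + i.1 := fun i => by simp [σ]
  have hR : Uᵀ * Uᵀᵀ = 1 := by rw [Matrix.transpose_transpose]; exact hU
  have key := kb_split_law (ι := Fin nΩ) σ hR
  set F := fun Ω : Fin n → Fin nΩ → ℝ =>
    ((fun i => (Uᵀ * Matrix.of Ω) (σ (Sum.inl i)),
      fun i => (Uᵀ * Matrix.of Ω) (σ (Sum.inr i))) :
      (Fin q → Fin nΩ → ℝ) × (Fin (n - q) → Fin nΩ → ℝ)) with hF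
  have hpre : kbM (Fin n) (Fin nΩ) (F ⁻¹' S)ᶜ ≥ ENNReal.ofReal (1 - δ) := by
    have hms : MeasurableSet (F ⁻¹' S) := key.measurable hSm
    rw [prob_compl_eq_one_sub hms, key.measure_preimage hSm.nullMeasurableSet,
      ENNReal.ofReal_sub _ hδ0.le, ENNReal.ofReal_one]
    exact tsub_le_tsub_left hSδ 1
  refine le_trans hpre (measure_mono ?_)
  intro Ω hΩ
  have hΩ' : F Ω ∉ S := hΩ
  intro r W hW hK
  rw [← hT2]
  refine kb_assemble hq hqn hk hU hU' hAU hanti hdn hW hK (sq_nonneg T) hlam rfl rfl hlq ?_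
  intro z hz
  have hb := hS _ hΩ' (fun i => z (σ (Sum.inl i))) (fun i => z (σ (Sum.inr i))) (by
    rw [← hz]
    simp only [hF]
    generalize Uᵀ * Matrix.of Ω = M
    ext j
    simp only [Matrix.mulVec, dotProduct, Matrix.transpose_apply, Pi.add_apply, Matrix.of_apply]
    rw [← σ.sum_comp, Fintype.sum_sum_type])
  rw [← kb_sum_sq, ← kb_sum_sq] at hb
  rw [← σ.sum_comp, ← σ.sum_comp, Fintype.sum_sum_type, Fintype.sum_sum_type]
  simp only [hσl, hσr, Fin.is_lt, if_true, add_lt_iff_neg_left, not_lt_zero, if_false,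
    Finset.sum_const_zero, add_zero, zero_add]
  exact hb
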